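/- arXiv:1708.07944 — 4 statements merged into one kernel-verified Lean document; each statement's English description precedes it below -/
import Mathlib

section
/- Assume hypothesis (H). Let f ∈ F[y]. Then there exist a finite set 𝐡 of irreducible polynomials in k[z,y] ∖ k[z], a nonzero g ∈ k[z], and a nonzero q ∈ D such that every coefficient of f lies in the localization D[1/q] ⊆ F, and such that for every positive integer d and every φ ∈ ℋ_D(d,𝐡,g) one has φ(q) ≠ 0, and the polynomial φ(f) obtained by applying the unique extension of φ to D[1/q] to the coefficients of f has a root in the field φ(D) if and only if f has a root in F. -/
set_option linter.unusedSectionVars false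
set_option linter.unusedVariables false

section HypH

variable {Ω : Type*} [Field Ω] [IsAlgClosed Ω] [CharZero Ω]
variable (k : Type*) [Field k] [Algebra k Ω]
variable (kbar : Type*) [Field kbar] [Algebra k kbar] [IsAlgClosure k kbar]
variable {m : ℕ} (z : Fin m → Ω) (δ : MvPolynomial (Fin m) k) (η : Ω)

/-- The algebra `D = k[z, 1/δ(z), η]` of hypothesis (H). -/
noncomputable def Dalg : Subalgebra k Ω :=
  Algebra.adjoin k (Set.range z ∪ {(MvPolynomial.aeval z δ)⁻¹, η})

theorem z_mem (i : Fin m) : z i ∈ Dalg k z δ η :=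
  Algebra.subset_adjoin (Set.mem_union_left _ ⟨i, rfl⟩)

theorem aeval_mem (g : MvPolynomial (Fin m) k) :
    MvPolynomial.aeval z g ∈ Dalg k z δ η := by
  have h : MvPolynomial.aeval z g ∈ Algebra.adjoin k (Set.range z) := by
    rw [Algebra.adjoin_range_eq_range_aeval]
    exact ⟨g, rfl⟩
  exact Algebra.adjoin_mono Set.subset_union_left h

/-- For `φ ∈ Hom_k(D,k̄)`, the polynomial `f(φ(z₁),…,φ(z_m),y)` with coefficients in the
subfield `k(φ(z₁),…,φ(z_m))` of `k̄`, obtained from `f ∈ k[z₁,…,z_m][y]`. -/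
noncomputable def specPoly (φ : ↥(Dalg k z δ η) →ₐ[k] kbar)
    (f : Polynomial (MvPolynomial (Fin m) k)) :
    Polynomial ↥(IntermediateField.adjoin k
      (Set.range fun i => φ ⟨z i, z_mem k z δ η i⟩)) :=
  f.map (MvPolynomial.aeval fun i =>
    (⟨φ ⟨z i, z_mem k z δ η i⟩,
      IntermediateField.subset_adjoin k _ ⟨i, rfl⟩⟩ :
      ↥(IntermediateField.adjoin k
        (Set.range fun i => φ ⟨z i, z_mem k z δ η i⟩)))).toRingHom

/-- The set `ℋ_D(d,𝐟,g)` of specializations. -/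
noncomputable def Hset (d : ℕ) (fs : Finset (Polynomial (MvPolynomial (Fin m) k)))
    (g : MvPolynomial (Fin m) k) : Set (↥(Dalg k z δ η) →ₐ[k] kbar) :=
  { φ | φ ⟨MvPolynomial.aeval z g, aeval_mem k z δ η g⟩ ≠ 0 ∧
    (∀ i : Fin m, Module.finrank k
      ↥(IntermediateField.adjoin k
        ((fun j => φ ⟨z j, z_mem k z δ η j⟩) '' { j : Fin m | j ≤ i })) = d ^ ((i : ℕ) + 1)) ∧
    ∀ f ∈ fs, 0 < (specPoly k kbar z δ η φ f).natDegree ∧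
      Irreducible (specPoly k kbar z δ η φ f) }

end HypH

section HypH2

variable {Ω : Type*} [Field Ω] [IsAlgClosed Ω] [CharZero Ω]
variable (k : Type*) [Field k] [Algebra k Ω]
variable {m : ℕ} (z : Fin m → Ω) (δ : MvPolynomial (Fin m) k) (η : Ω)

/-- The localization `D[1/q]` of `D` inside `Ω`. -/
noncomputable def Dadj (q : ↥(Dalg k z δ η)) : Subalgebra k Ω :=
  Algebra.adjoin k ((Dalg k z δ η : Set Ω) ∪ {(q : Ω)⁻¹})

theorem le_Dadj (q : ↥(Dalg k z δ η)) : Dalg k z δ η ≤ Dadj k z δ η q :=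
  fun _ hx => Algebra.subset_adjoin (Set.mem_union_left _ hx)

/-- The field of fractions `F` of `D` inside `Ω` (the subfield generated by `D`). -/
noncomputable def Ffield : Subfield Ω := Subfield.closure (Dalg k z δ η : Set Ω)

end HypH2

open Polynomial in
/-- A root outside a finite extension `F` of `K` yields an element of `F(θ)`, written as a
polynomial in `θ` over `F`, whose degree over `K` exceeds `[F : K]`. -/
theorem exists_finrank_lt_natDegree_minpoly_aeval {K F Ω : Type*} [Field K] [CharZero K] [Field F]
    [Field Ω] [Algebra K F] [Algebra F Ω] [Algebra K Ω] [IsScalarTower K F Ω]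
    [FiniteDimensional K F] {θ : Ω} (hθ : IsIntegral F θ) (hmem : θ ∉ Set.range (algebraMap F Ω)) :
    ∃ P : F[X], Module.finrank K F < (minpoly K (aeval θ P)).natDegree := by
  let E := IntermediateField.adjoin F {θ}
  have : FiniteDimensional F E := IntermediateField.adjoin.finiteDimensional hθ
  have : FiniteDimensional K E := FiniteDimensional.trans K F E
  obtain ⟨α, hα⟩ := Field.exists_primitive_element K E
  have hαm : (α : Ω) ∈ E.toSubalgebra := α.2
  rw [IntermediateField.adjoin_simple_toSubalgebra_of_isAlgebraic hθ.isAlgebraic,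
    Algebra.adjoin_singleton_eq_range_aeval] at hαm
  obtain ⟨P, hP⟩ := hαm
  refine ⟨P, ?_⟩
  change aeval θ P = _ at hP
  have h1 := (Field.primitive_element_iff_minpoly_natDegree_eq K α).1 hα
  have : IsScalarTower K E Ω := .of_algebraMap_eq fun x => by
    rw [IsScalarTower.algebraMap_apply K F E, ← IsScalarTower.algebraMap_apply F E Ω,
      ← IsScalarTower.algebraMap_apply K F Ω]
  have h2 : minpoly K (α : Ω) = minpoly K α :=
    minpoly.algebraMap_eq (algebraMap E Ω).injective α
  rw [hP, h2, h1, ← Module.finrank_mul_finrank K F E]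
  have h3 : Module.finrank F E ≠ 1 := fun h =>
    hmem (IntermediateField.mem_bot.1 (IntermediateField.finrank_adjoin_simple_eq_one_iff.1 h))
  have h4 : 0 < Module.finrank F E := Module.finrank_pos
  have h5 : 0 < Module.finrank K F := Module.finrank_pos
  nlinarith [show 2 ≤ Module.finrank F E by omega]

open Polynomial in
theorem exists_irreducible_aeval_eq_zero {R Ω : Type*} [CommRing R] [IsDomain R]
    [UniqueFactorizationMonoid R] [Field Ω] [Algebra R Ω] {α : Ω} (hα : IsAlgebraic R α) :
    ∃ h : R[X], Irreducible h ∧ aeval α h = 0 := by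
  obtain ⟨p, hp0, hp⟩ := hα
  by_contra! hcon
  refine absurd hp ?_
  clear hp
  induction p using WfDvdMonoid.induction_on_irreducible with
  | zero => exact absurd rfl hp0
  | unit u hu => exact (hu.map (aeval α)).ne_zero
  | mul a i ha hi ih =>
    rw [map_mul]
    exact mul_ne_zero (hcon i hi) (ih ha)

open Polynomial in
theorem natDegree_minpoly_le_of_aeval_eq_zero (K : Type*) {R Ω : Type*} [CommRing R] [IsDomain R]
    [Field K] [Field Ω] [Algebra R Ω] [Algebra R K] [IsFractionRing R K] [Algebra K Ω]
    [IsScalarTower R K Ω] {α : Ω} {h : R[X]} (h0 : h ≠ 0) (hα : aeval α h = 0) :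
    (minpoly K α).natDegree ≤ h.natDegree := by
  have hinj := IsFractionRing.injective R K
  rw [← natDegree_map_eq_of_injective hinj h]
  refine natDegree_le_natDegree (minpoly.degree_le_of_ne_zero K α ?_ ?_)
  · rwa [Ne, Polynomial.map_eq_zero_iff hinj]
  · rwa [aeval_map_algebraMap]

open Polynomial in
theorem exists_natDegree_le_minpoly_aeval_eq_zero (K : Type*) {R Ω : Type*} [CommRing R]
    [IsDomain R] [Field K] [Field Ω] [Algebra R Ω] [Algebra R K] [IsFractionRing R K] [Algebra K Ω]
    [IsScalarTower R K Ω] {η : Ω} (hη : IsIntegral K η) :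
    ∃ e : R[X], e ≠ 0 ∧ aeval η e = 0 ∧ e.natDegree ≤ (minpoly K η).natDegree := by
  refine ⟨IsLocalization.integerNormalization (nonZeroDivisors R) (minpoly K η), ?_, ?_, ?_⟩
  · rw [Ne, IsFractionRing.integerNormalization_eq_zero_iff]
    exact minpoly.ne_zero hη
  · exact IsLocalization.integerNormalization_aeval_eq_zero _ _ (minpoly.aeval K η)
  · exact natDegree_le_natDegree
      (degree_mono (IsLocalization.integerNormalization_support _ _))

open Polynomial in
/-- If a nonzero `f` over `F = K(η)`, `K = Frac R`, has no root in `F`, then `f` divides over `F` a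
product of polynomials `h(P(y))` with `h` irreducible over `R` of degree exceeding that of a fixed
polynomial over `R` annihilating `η`. -/
theorem exists_dvd_prod_comp_of_forall_eval_ne_zero (K : Type*) {R Ω : Type*} [CommRing R]
    [IsDomain R] [UniqueFactorizationMonoid R] [Field K] [CharZero K] [Field Ω] [IsAlgClosed Ω]
    [Algebra R Ω] [Algebra R K] [IsFractionRing R K] [Algebra K Ω] [IsScalarTower R K Ω] {η : Ω}
    (hη : IsIntegral K η) {f : Polynomial Ω}
    (hf : f ∈ lifts (algebraMap (IntermediateField.adjoin K {η}) Ω))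
    (hroot : ∀ x ∈ IntermediateField.adjoin K {η}, f.eval x ≠ 0) :
    ∃ e : R[X], e ≠ 0 ∧ aeval η e = 0 ∧ ∃ s : Multiset (R[X] × Polynomial Ω),
      (∀ p ∈ s, Irreducible p.1 ∧ e.natDegree < p.1.natDegree ∧
        p.2 ∈ lifts (algebraMap (IntermediateField.adjoin K {η}) Ω)) ∧
      ∃ w ∈ lifts (algebraMap (IntermediateField.adjoin K {η}) Ω),
        f * w = (s.map fun p => (p.1.map (algebraMap R Ω)).comp p.2).prod := by
  classical
  set F := IntermediateField.adjoin K {η} with hF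
  have : FiniteDimensional K F := IntermediateField.adjoin.finiteDimensional hη
  obtain ⟨e, he0, he, hdeg⟩ := exists_natDegree_le_minpoly_aeval_eq_zero (R := R) K hη
  obtain ⟨f, rfl⟩ := (mem_lifts _).1 hf
  set ι := algebraMap F Ω with hι
  have hf0 : f ≠ 0 := by
    rintro rfl
    exact hroot 0 (zero_mem _) (by simp)
  have key : ∀ θ ∈ (f.map ι).roots, ∃ p : R[X] × F[X], Irreducible p.1 ∧
      e.natDegree < p.1.natDegree ∧ aeval (aeval θ p.2) p.1 = 0 := by
    intro θ hθ
    have hθ0 : (f.map ι).eval θ = 0 := (mem_roots'.1 hθ).2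
    have hθF : IsAlgebraic F θ := ⟨f, hf0, by rwa [← eval_map_algebraMap]⟩
    have hmem : θ ∉ Set.range ι := by
      rintro ⟨x, rfl⟩
      exact hroot _ x.2 hθ0
    obtain ⟨P, hP⟩ := exists_finrank_lt_natDegree_minpoly_aeval (K := K) hθF.isIntegral hmem
    have hθK : IsAlgebraic K (aeval θ P) := by
      have : IsIntegral F (aeval θ P) :=
        adjoin_le_integralClosure hθF.isIntegral (aeval_mem_adjoin_singleton F θ)
      exact this.isAlgebraic.restrictScalars K
    obtain ⟨h, hirr, hh⟩ := exists_irreducible_aeval_eq_zero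
      ((IsFractionRing.isAlgebraic_iff R K Ω).2 hθK)
    refine ⟨(h, P), hirr, ?_, hh⟩
    refine lt_of_le_of_lt hdeg (lt_of_le_of_lt ?_
      (lt_of_lt_of_le hP (natDegree_minpoly_le_of_aeval_eq_zero K hirr.ne_zero hh)))
    exact (IntermediateField.adjoin.finrank hη).ge
  choose! p hp1 hp2 hp3 using key
  have : IsScalarTower R F Ω := .of_algebraMap_eq fun x => by
    rw [IsScalarTower.algebraMap_apply R K F, ← IsScalarTower.algebraMap_apply K F Ω,
      ← IsScalarTower.algebraMap_apply R K Ω]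
  have hcomp : ∀ θ, (((p θ).1.map (algebraMap R F)).comp (p θ).2).map ι =
      ((p θ).1.map (algebraMap R Ω)).comp ((p θ).2.map ι) := fun θ => by
    rw [Polynomial.map_comp, Polynomial.map_map, hι, ← IsScalarTower.algebraMap_eq]
  have hdvd : f ∣ ((f.map ι).roots.map fun θ =>
      ((p θ).1.map (algebraMap R F)).comp (p θ).2).prod := by
    rw [← map_dvd_map' ι, Polynomial.map_multiset_prod, Multiset.map_map]
    conv_lhs => rw [(IsAlgClosed.splits (f.map ι)).eq_prod_roots]
    rw [(isUnit_C.2 (leadingCoeff_ne_zero.2 (by rwa [Polynomial.map_ne_zero_iff ι.injective])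
      |>.isUnit)).mul_left_dvd]
    refine Multiset.prod_dvd_prod_of_dvd _ _ fun θ hθ => ?_
    rw [Function.comp_apply, hcomp, dvd_iff_isRoot, IsRoot, eval_comp, eval_map_algebraMap,
      hι, eval_map_algebraMap]
    exact hp3 θ hθ
  obtain ⟨w, hw⟩ := hdvd
  refine ⟨e, he0, he, (f.map ι).roots.map fun θ => ((p θ).1, (p θ).2.map ι), ?_, w.map ι,
    (mem_lifts _).2 ⟨w, rfl⟩, ?_⟩
  · intro q hq
    obtain ⟨θ, hθ, rfl⟩ := Multiset.mem_map.1 hq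
    exact ⟨hp1 θ hθ, hp2 θ hθ, (mem_lifts _).2 ⟨_, rfl⟩⟩
  · rw [← Polynomial.map_mul, ← hw, Polynomial.map_multiset_prod, Multiset.map_map,
      Multiset.map_map]
    simp only [Function.comp_def, hcomp]

open Polynomial in
theorem natDegree_le_of_irreducible_of_mem_adjoin {L M : Type*} [Field L] [Field M] [Algebra L M]
    {η x : M} (hx : x ∈ IntermediateField.adjoin L {η}) {e h : L[X]} (he0 : e ≠ 0)
    (he : aeval η e = 0) (hh : Irreducible h) (hhx : aeval x h = 0) :
    h.natDegree ≤ e.natDegree := by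
  have hη : IsIntegral L η := IsAlgebraic.isIntegral ⟨e, he0, he⟩
  have hxi : IsIntegral L x := IsAlgebraic.isIntegral ⟨h, hh.ne_zero, hhx⟩
  have := IntermediateField.adjoin.finiteDimensional hη
  have h1 : h.natDegree = (minpoly L x).natDegree :=
    natDegree_eq_of_degree_eq (degree_eq_degree_of_associated
      ((minpoly.irreducible hxi).associated_of_dvd hh (minpoly.dvd L x hhx)).symm)
  have h2 : (minpoly L x).natDegree ≤ Module.finrank L (IntermediateField.adjoin L {η}) := by
    have := minpoly.natDegree_le (A := L) (⟨x, hx⟩ : IntermediateField.adjoin L {η})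
    rwa [← minpoly.algebraMap_eq (algebraMap (IntermediateField.adjoin L {η}) M).injective] at this
  rw [h1]
  refine h2.trans ?_
  rw [IntermediateField.adjoin.finrank hη]
  exact natDegree_le_natDegree (minpoly.degree_le_of_ne_zero L η he0 he)

theorem apply_mul_pow_eq_of_comp_inclusion {k Ω M : Type*} [Field k] [Field Ω] [Algebra k Ω]
    [Field M] [Algebra k M] {A B : Subalgebra k Ω} (hAB : A ≤ B) {q : A} {x : B} {n : ℕ}
    (hn : (q : Ω) ^ n * x ∈ A) {φ : A →ₐ[k] M} {ψ : B →ₐ[k] M}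
    (hψ : ψ.comp (Subalgebra.inclusion hAB) = φ) : ψ x * φ q ^ n = φ ⟨_, hn⟩ := by
  subst hψ
  rw [AlgHom.comp_apply, AlgHom.comp_apply, ← map_pow, ← map_pow, ← map_mul]
  exact congrArg ψ (Subtype.ext (mul_comm _ _))

theorem IsLocalization.Away.exists_algHom_extending {k A M : Type*} [CommRing k] [CommRing A]
    [CommRing M] [Algebra k A] [Algebra k M] (q : A) (B : Type*) [CommRing B] [Algebra k B]
    [Algebra A B] [IsScalarTower k A B] [IsLocalization.Away q B] (φ : A →ₐ[k] M)
    (hφ : IsUnit (φ q)) : ∃ ψ : B →ₐ[k] M, ∀ x, ψ (algebraMap A B x) = φ x := by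
  have hu : ∀ y : Submonoid.powers q, IsUnit (φ y) := by
    rintro ⟨_, n, rfl⟩
    rw [map_pow]
    exact hφ.pow n
  exact ⟨IsLocalization.liftAlgHom (M := Submonoid.powers q) hu, fun x =>
    IsLocalization.lift_eq (M := Submonoid.powers q) (g := φ.toRingHom) hu x⟩

/-- The universal property of the localization `A[1/q]`, for subalgebras of a field. -/
theorem existsUnique_algHom_comp_inclusion {k Ω M : Type*} [Field k] [Field Ω] [Algebra k Ω]
    [Field M] [Algebra k M] {A B : Subalgebra k Ω} (hAB : A ≤ B) {q : A} (hinv : (q : Ω)⁻¹ ∈ B)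
    (hpow : ∀ x ∈ B, ∃ n : ℕ, (q : Ω) ^ n * x ∈ A) (φ : A →ₐ[k] M) (hφ : φ q ≠ 0) :
    ∃! ψ : B →ₐ[k] M, ψ.comp (Subalgebra.inclusion hAB) = φ := by
  have hq : (q : Ω) ≠ 0 := fun h => hφ (by rw [(Subtype.ext h : q = 0), map_zero])
  refine existsUnique_of_exists_of_unique ?_ ?_
  · let := (Subalgebra.inclusion hAB).toRingHom.toAlgebra
    have : IsScalarTower k A B :=
      .of_algebraMap_eq fun x => ((Subalgebra.inclusion hAB).commutes x).symm
    have hloc : IsLocalization.Away q B := by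
      refine IsLocalization.Away.mk q ?_ ?_ ?_
      · exact IsUnit.of_mul_eq_one ⟨(q : Ω)⁻¹, hinv⟩ (Subtype.ext (mul_inv_cancel₀ hq))
      · intro x
        obtain ⟨n, hn⟩ := hpow x x.2
        exact ⟨n, ⟨_, hn⟩, Subtype.ext (mul_comm _ _)⟩
      · intro a b hab
        exact ⟨0, by rw [Subalgebra.inclusion_injective hAB hab]⟩
    obtain ⟨ψ, hψ⟩ := IsLocalization.Away.exists_algHom_extending q B φ
      (isUnit_iff_ne_zero.2 hφ)
    exact ⟨ψ, AlgHom.ext hψ⟩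
  · intro ψ₁ ψ₂ h₁ h₂
    refine AlgHom.ext fun x => ?_
    obtain ⟨n, hn⟩ := hpow x x.2
    exact mul_right_cancel₀ (pow_ne_zero n hφ)
      ((apply_mul_pow_eq_of_comp_inclusion hAB hn h₁).trans
        (apply_mul_pow_eq_of_comp_inclusion hAB hn h₂).symm)

theorem Subalgebra.coe_mvPolynomial_aeval {k Ω σ : Type*} [Field k] [Field Ω] [Algebra k Ω]
    (A : Subalgebra k Ω) {z : σ → Ω} (hz : ∀ i, z i ∈ A) (g : MvPolynomial σ k) :
    ((MvPolynomial.aeval (fun i => (⟨z i, hz i⟩ : A)) g : A) : Ω) = MvPolynomial.aeval z g :=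
  MvPolynomial.comp_aeval_apply (fun i => (⟨z i, hz i⟩ : A)) A.val g

theorem Subalgebra.apply_mk_mvPolynomial_aeval {k Ω M σ : Type*} [Field k] [Field Ω] [Algebra k Ω]
    [Field M] [Algebra k M] {A : Subalgebra k Ω} {z : σ → Ω} (hz : ∀ i, z i ∈ A) (φ : A →ₐ[k] M)
    {g : MvPolynomial σ k} (hg : MvPolynomial.aeval z g ∈ A) :
    φ ⟨MvPolynomial.aeval z g, hg⟩ = MvPolynomial.aeval (fun i => φ ⟨z i, hz i⟩) g := by
  rw [← MvPolynomial.comp_aeval_apply (fun i => (⟨z i, hz i⟩ : A)) φ g]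
  exact congrArg φ (Subtype.ext (A.coe_mvPolynomial_aeval hz g).symm)

section Localization

variable {Ω : Type*} [Field Ω] [IsAlgClosed Ω] [CharZero Ω] {k : Type*} [Field k] [Algebra k Ω]
  {kbar : Type*} [Field kbar] [Algebra k kbar] [IsAlgClosure k kbar]
  {m : ℕ} {z : Fin m → Ω} {δ : MvPolynomial (Fin m) k} {η : Ω}

theorem exists_pow_mul_mem_Dalg {q : Dalg k z δ η} (hq : q ≠ 0) {x : Ω}
    (hx : x ∈ Dadj k z δ η q) : ∃ n : ℕ, (q : Ω) ^ n * x ∈ Dalg k z δ η := by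
  have hq' : (q : Ω) ≠ 0 := by simpa using hq
  refine Algebra.adjoin_induction (p := fun x _ => ∃ n : ℕ, (q : Ω) ^ n * x ∈ Dalg k z δ η)
    ?_ ?_ ?_ ?_ hx
  · rintro x (hx | rfl)
    · exact ⟨0, by simpa using hx⟩
    · exact ⟨1, by simp [hq', one_mem]⟩
  · exact fun r => ⟨0, by simp⟩
  · rintro x y _ _ ⟨a, ha⟩ ⟨b, hb⟩
    refine ⟨a + b, ?_⟩
    have : (q : Ω) ^ (a + b) * (x + y) = (q : Ω) ^ b * ((q : Ω) ^ a * x) +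
        (q : Ω) ^ a * ((q : Ω) ^ b * y) := by ring
    rw [this]
    exact add_mem (mul_mem (pow_mem q.2 _) ha) (mul_mem (pow_mem q.2 _) hb)
  · rintro x y _ _ ⟨a, ha⟩ ⟨b, hb⟩
    refine ⟨a + b, ?_⟩
    have : (q : Ω) ^ (a + b) * (x * y) = ((q : Ω) ^ a * x) * ((q : Ω) ^ b * y) := by ring
    rw [this]
    exact mul_mem ha hb

theorem mem_Dadj_of_mul_mem {q : Dalg k z δ η} (hq : q ≠ 0) {x : Ω}
    (hx : (q : Ω) * x ∈ Dalg k z δ η) : x ∈ Dadj k z δ η q := by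
  have hq' : (q : Ω) ≠ 0 := by simpa using hq
  have h := mul_mem (le_Dadj k z δ η q hx)
    (Algebra.subset_adjoin (Set.mem_union_right _ rfl) : (q : Ω)⁻¹ ∈ Dadj k z δ η q)
  rwa [mul_comm (q : Ω), mul_inv_cancel_right₀ hq'] at h

theorem Dadj_subset_Ffield (q : Dalg k z δ η) :
    (Dadj k z δ η q : Set Ω) ⊆ (Ffield k z δ η : Set Ω) := by
  have hD : ∀ x ∈ Dalg k z δ η, x ∈ Ffield k z δ η := fun x hx => Subfield.subset_closure hx
  intro x hx
  refine Algebra.adjoin_induction (p := fun x _ => x ∈ Ffield k z δ η) ?_ ?_ ?_ ?_ hx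
  · rintro x (hx | rfl)
    · exact hD x hx
    · exact inv_mem (hD _ q.2)
  · exact fun r => hD _ (Subalgebra.algebraMap_mem _ r)
  · exact fun _ _ _ _ => add_mem
  · exact fun _ _ _ _ => mul_mem

theorem existsUnique_extension_Dadj {q : Dalg k z δ η} (φ : Dalg k z δ η →ₐ[k] kbar)
    (hφ : φ q ≠ 0) : ∃! ψ : Dadj k z δ η q →ₐ[k] kbar,
      ψ.comp (Subalgebra.inclusion (le_Dadj k z δ η q)) = φ :=
  existsUnique_algHom_comp_inclusion _
    (Algebra.subset_adjoin (Set.mem_union_right _ rfl) : (q : Ω)⁻¹ ∈ Dadj k z δ η q)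
    (fun _ => exists_pow_mul_mem_Dalg (fun h => hφ (by rw [h, map_zero]))) φ hφ

theorem extension_apply_mem_range {q : Dalg k z δ η} {φ : Dalg k z δ η →ₐ[k] kbar} (hφ : φ q ≠ 0)
    {ψ : Dadj k z δ η q →ₐ[k] kbar}
    (hψ : ψ.comp (Subalgebra.inclusion (le_Dadj k z δ η q)) = φ) (x : Dadj k z δ η q) :
    ψ x ∈ φ.range := by
  obtain ⟨n, hn⟩ := exists_pow_mul_mem_Dalg (fun h => hφ (by rw [h, map_zero])) x.2
  have := IsAlgClosure.isAlgebraic (R := k) (K := kbar)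
  have hinv : (φ (q ^ n))⁻¹ ∈ φ.range := φ.range.inv_mem_of_algebraic
    (x := ⟨φ (q ^ n), ⟨_, rfl⟩⟩) (Algebra.IsAlgebraic.isAlgebraic (φ (q ^ n)))
  have h1 : ψ x = φ ⟨_, hn⟩ * (φ (q ^ n))⁻¹ := by
    rw [← apply_mul_pow_eq_of_comp_inclusion (le_Dadj k z δ η q) hn hψ, map_pow,
      mul_inv_cancel_right₀ (pow_ne_zero n hφ)]
  rw [h1]
  exact mul_mem ⟨_, rfl⟩ hinv

theorem apply_mk_aeval (φ : Dalg k z δ η →ₐ[k] kbar) (g : MvPolynomial (Fin m) k) :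
    φ ⟨MvPolynomial.aeval z g, aeval_mem k z δ η g⟩ =
      MvPolynomial.aeval (fun i => φ ⟨z i, z_mem k z δ η i⟩) g :=
  Subalgebra.apply_mk_mvPolynomial_aeval (z_mem k z δ η) φ (aeval_mem k z δ η g)

theorem apply_mem_adjoin (hδ : MvPolynomial.aeval z δ ≠ 0) (φ : Dalg k z δ η →ₐ[k] kbar)
    (x : Dalg k z δ η) :
    φ x ∈ IntermediateField.adjoin (IntermediateField.adjoin k
        (Set.range fun i => φ ⟨z i, z_mem k z δ η i⟩))
      {φ ⟨η, Algebra.subset_adjoin (Or.inr (Or.inr rfl))⟩} := by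
  set L := IntermediateField.adjoin k (Set.range fun i => φ ⟨z i, z_mem k z δ η i⟩) with hL
  set E := IntermediateField.adjoin L {φ ⟨η, Algebra.subset_adjoin (Or.inr (Or.inr rfl))⟩}
  have hLE : ∀ y ∈ L, y ∈ E := fun y hy => E.algebraMap_mem ⟨y, hy⟩
  have hz : ∀ i, φ ⟨z i, z_mem k z δ η i⟩ ∈ L := fun i =>
    IntermediateField.subset_adjoin k _ ⟨i, rfl⟩
  obtain ⟨x, hx⟩ := x
  refine Algebra.adjoin_induction (p := fun x hx => φ ⟨x, hx⟩ ∈ E) ?_ ?_ ?_ ?_ hx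
  · rintro x (⟨i, rfl⟩ | rfl | rfl)
    · exact hLE _ (hz i)
    · have h1 : (⟨MvPolynomial.aeval z δ, aeval_mem k z δ η δ⟩ : Dalg k z δ η) *
          ⟨(MvPolynomial.aeval z δ)⁻¹, Algebra.subset_adjoin (Or.inr (Or.inl rfl))⟩ = 1 := by
        ext
        exact mul_inv_cancel₀ hδ
      have h2 := congrArg φ h1
      rw [map_mul, map_one] at h2
      have h3 := eq_inv_of_mul_eq_one_right h2
      rw [h3]
      refine inv_mem (hLE _ ?_)
      rw [apply_mk_aeval]
      have h4 := MvPolynomial.comp_aeval_apply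
        (fun i => (⟨φ ⟨z i, z_mem k z δ η i⟩, hz i⟩ : L)) L.val δ
      exact (congrArg (· ∈ L) h4).mp (Subtype.prop _)
    · exact IntermediateField.subset_adjoin L _ rfl
  · intro r
    have : φ ⟨algebraMap k Ω r, Subalgebra.algebraMap_mem _ r⟩ = algebraMap k kbar r :=
      φ.commutes r
    rw [this]
    exact hLE _ (L.algebraMap_mem r)
  · intro x y hx hy h1 h2
    exact (map_add φ ⟨x, hx⟩ ⟨y, hy⟩).symm ▸ add_mem h1 h2
  · intro x y hx hy h1 h2
    exact (map_mul φ ⟨x, hx⟩ ⟨y, hy⟩).symm ▸ mul_mem h1 h2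

end Localization

section Generic

variable {Ω : Type*} [Field Ω] [IsAlgClosed Ω] [CharZero Ω] {k : Type*} [Field k] [Algebra k Ω]
  {m : ℕ} {z : Fin m → Ω} {δ : MvPolynomial (Fin m) k} {η : Ω}
  {K : Type*} [Field K] [Algebra (MvPolynomial (Fin m) k) K]
  [IsFractionRing (MvPolynomial (Fin m) k) K] [Algebra (MvPolynomial (Fin m) k) Ω] [Algebra K Ω]
  [IsScalarTower (MvPolynomial (Fin m) k) K Ω]

theorem aeval_mem_range_algebraMap
    (hR : ∀ r : MvPolynomial (Fin m) k, algebraMap _ Ω r = MvPolynomial.aeval z r)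
    (r : MvPolynomial (Fin m) k) : MvPolynomial.aeval z r ∈ (algebraMap K Ω).fieldRange :=
  ⟨algebraMap _ K r, by rw [← IsScalarTower.algebraMap_apply, hR]⟩

theorem mem_Ffield_iff
    (hR : ∀ r : MvPolynomial (Fin m) k, algebraMap _ Ω r = MvPolynomial.aeval z r) (x : Ω) :
    x ∈ Ffield k z δ η ↔ x ∈ IntermediateField.adjoin K {η} := by
  have haev : ∀ r, MvPolynomial.aeval z r ∈ IntermediateField.adjoin K {η} := fun r => by
    obtain ⟨a, ha⟩ := aeval_mem_range_algebraMap (K := K) hR r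
    exact ha ▸ IntermediateField.algebraMap_mem _ a
  constructor
  · intro hx
    have h : Ffield k z δ η ≤ (IntermediateField.adjoin K {η}).toSubfield := by
      refine Subfield.closure_le.2 fun y hy => ?_
      refine Algebra.adjoin_induction
        (p := fun y _ => y ∈ IntermediateField.adjoin K {η}) ?_ ?_ ?_ ?_ hy
      · rintro y (⟨i, rfl⟩ | rfl | rfl)
        · simpa using haev (MvPolynomial.X i)
        · exact inv_mem (haev δ)
        · exact IntermediateField.subset_adjoin K _ rfl
      · intro r
        simpa using haev (MvPolynomial.C r)
      · exact fun _ _ _ _ => add_mem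
      · exact fun _ _ _ _ => mul_mem
    exact h hx
  · intro hx
    have hD : ∀ y ∈ Dalg k z δ η, y ∈ Ffield k z δ η := fun y hy => Subfield.subset_closure hy
    refine IntermediateField.adjoin_induction (p := fun y _ => y ∈ Ffield k z δ η) K
      ?_ ?_ ?_ ?_ ?_ hx
    · rintro y rfl
      exact hD _ (Algebra.subset_adjoin (Or.inr (Or.inr rfl)))
    · intro a
      obtain ⟨r, s, -, rfl⟩ := IsFractionRing.div_surjective (A := MvPolynomial (Fin m) k) a
      rw [map_div₀, ← IsScalarTower.algebraMap_apply, ← IsScalarTower.algebraMap_apply, hR, hR]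
      exact div_mem (hD _ (aeval_mem k z δ η r)) (hD _ (aeval_mem k z δ η s))
    · exact fun _ _ _ _ => add_mem
    · exact fun _ _ => inv_mem
    · exact fun _ _ _ _ => mul_mem

theorem isIntegral_of_isIntegral_adjoin
    (hR : ∀ r : MvPolynomial (Fin m) k, algebraMap _ Ω r = MvPolynomial.aeval z r)
    (hη : IsIntegral (Algebra.adjoin k (Set.range z ∪ {(MvPolynomial.aeval z δ)⁻¹})) η) :
    IsIntegral K η := by
  set B := Algebra.adjoin k (Set.range z ∪ {(MvPolynomial.aeval z δ)⁻¹}) with hB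
  have hBK : ∀ x ∈ B, x ∈ (algebraMap K Ω).fieldRange := by
    intro x hx
    have haev := aeval_mem_range_algebraMap (K := K) hR
    refine Algebra.adjoin_induction (p := fun y _ => y ∈ (algebraMap K Ω).fieldRange)
      ?_ ?_ ?_ ?_ hx
    · rintro y (⟨i, rfl⟩ | rfl)
      · simpa using haev (MvPolynomial.X i)
      · exact inv_mem (haev δ)
    · intro r
      simpa using haev (MvPolynomial.C r)
    · exact fun _ _ _ _ => add_mem
    · exact fun _ _ _ _ => mul_mem
  obtain ⟨p, hp, hp0⟩ := hη
  have hl : p.map (algebraMap B Ω) ∈ Polynomial.lifts (algebraMap K Ω) :=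
    (Polynomial.lifts_iff_coeff_lifts _).2 fun n => by
      rw [Polynomial.coeff_map]
      exact hBK _ (p.coeff n).2
  obtain ⟨q, hq, -, hqm⟩ := Polynomial.lifts_and_natDegree_eq_and_monic hl (hp.map _)
  refine ⟨q, hqm, ?_⟩
  rw [← Polynomial.eval_map, hq, Polynomial.eval_map, hp0]

theorem exists_aeval_mul_mem_Dalg
    (hR : ∀ r : MvPolynomial (Fin m) k, algebraMap _ Ω r = MvPolynomial.aeval z r)
    (hη : IsIntegral K η) {x : Ω} (hx : x ∈ Ffield k z δ η) :
    ∃ g : MvPolynomial (Fin m) k, g ≠ 0 ∧ MvPolynomial.aeval z g * x ∈ Dalg k z δ η := by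
  have hcl : ∀ y ∈ Subring.closure (Dalg k z δ η : Set Ω), y ∈ Dalg k z δ η := fun y hy =>
    (Subring.closure_le (t := (Dalg k z δ η).toSubring)).2 (fun _ h => h) hy
  obtain ⟨a, ha, b, hb, rfl⟩ := Subfield.mem_closure_iff.1 hx
  have ha := hcl a ha
  have hb := hcl b hb
  rcases eq_or_ne b 0 with rfl | hb0
  · exact ⟨1, one_ne_zero, by simp⟩
  have hbF : b ∈ IntermediateField.adjoin K {η} :=
    (mem_Ffield_iff hR b).1 (Subfield.subset_closure hb)
  have := IntermediateField.adjoin.finiteDimensional hη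
  have hbK : IsAlgebraic K b := isAlgebraic_algebraMap_iff
    (algebraMap (IntermediateField.adjoin K {η}) Ω).injective |>.2
      (Algebra.IsAlgebraic.isAlgebraic (⟨b, hbF⟩ : IntermediateField.adjoin K {η}))
  have hbR : IsAlgebraic (MvPolynomial (Fin m) k) b := (IsFractionRing.isAlgebraic_iff _ K Ω).2 hbK
  let S := Algebra.adjoin (MvPolynomial (Fin m) k) {b}
  let b' : S := ⟨b, Algebra.self_mem_adjoin_singleton _ b⟩
  have hbS : IsAlgebraic (MvPolynomial (Fin m) k) b' :=
    (isAlgebraic_algHom_iff S.val Subtype.val_injective).1 hbR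
  have hb'0 : b' ≠ 0 := fun h => hb0 (congrArg Subtype.val h)
  obtain ⟨g, hg0, c, hc⟩ := hbS.exists_nonzero_dvd (mem_nonZeroDivisors_of_ne_zero hb'0)
  have hcD : (c : Ω) ∈ Dalg k z δ η := by
    refine Algebra.adjoin_induction (p := fun y _ => y ∈ Dalg k z δ η) ?_ ?_ ?_ ?_ c.2
    · rintro y rfl
      exact hb
    · intro r
      rw [hR]
      exact aeval_mem k z δ η r
    · exact fun _ _ _ _ => add_mem
    · exact fun _ _ _ _ => mul_mem
  refine ⟨g, hg0, ?_⟩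
  have hc' : MvPolynomial.aeval z g = b * c := by
    rw [← hR]
    exact congrArg Subtype.val hc
  rw [hc', show b * (c : Ω) * (a / b) = c * a by field_simp]
  exact mul_mem hcD ha

theorem exists_forall_aeval_mul_mem_Dalg
    (hR : ∀ r : MvPolynomial (Fin m) k, algebraMap _ Ω r = MvPolynomial.aeval z r)
    (hη : IsIntegral K η) (S : Finset Ω) (hS : ∀ x ∈ S, x ∈ Ffield k z δ η) :
    ∃ g : MvPolynomial (Fin m) k, g ≠ 0 ∧ ∀ x ∈ S, MvPolynomial.aeval z g * x ∈ Dalg k z δ η := by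
  classical
  have h : ∀ x ∈ S, ∃ g : MvPolynomial (Fin m) k, g ≠ 0 ∧
      MvPolynomial.aeval z g * x ∈ Dalg k z δ η := fun x hx =>
    exists_aeval_mul_mem_Dalg hR hη (hS x hx)
  choose! g hg0 hg using h
  refine ⟨∏ x ∈ S, g x, Finset.prod_ne_zero_iff.2 hg0, fun x hx => ?_⟩
  rw [← Finset.prod_erase_mul _ _ hx, map_mul, mul_assoc]
  exact mul_mem (aeval_mem k z δ η _) (hg x hx)

/-- A common denominator in `k[z]` for the coefficients of finitely many polynomials over `F`. -/
theorem exists_forall_aeval_mul_coeff_mem_Dalg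
    (hR : ∀ r : MvPolynomial (Fin m) k, algebraMap _ Ω r = MvPolynomial.aeval z r)
    (hη : IsIntegral K η) (T : Multiset (Polynomial Ω))
    (hT : ∀ p ∈ T, ∀ n, p.coeff n ∈ Ffield k z δ η) :
    ∃ g : MvPolynomial (Fin m) k, g ≠ 0 ∧
      ∀ p ∈ T, ∀ n, MvPolynomial.aeval z g * p.coeff n ∈ Dalg k z δ η := by
  classical
  obtain ⟨g, hg0, hg⟩ := exists_forall_aeval_mul_mem_Dalg hR hη
    (T.toFinset.biUnion fun p => p.coeffs) (fun x hx => by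
      obtain ⟨p, hp, hxp⟩ := Finset.mem_biUnion.1 hx
      obtain ⟨n, -, rfl⟩ := Polynomial.mem_coeffs_iff.1 hxp
      exact hT p (Multiset.mem_toFinset.1 hp) n)
  refine ⟨g, hg0, fun p hp n => ?_⟩
  by_cases h0 : p.coeff n = 0
  · simp [h0, zero_mem]
  · exact hg _ (Finset.mem_biUnion.2
      ⟨p, Multiset.mem_toFinset.2 hp, Polynomial.coeff_mem_coeffs h0⟩)

end Generic

theorem IntermediateField.coe_mvPolynomial_aeval {k M σ : Type*} [Field k] [Field M] [Algebra k M]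
    (L : IntermediateField k M) {v : σ → M} (hv : ∀ i, v i ∈ L) (g : MvPolynomial σ k) :
    ((MvPolynomial.aeval (fun i => (⟨v i, hv i⟩ : L)) g : L) : M) = MvPolynomial.aeval v g :=
  MvPolynomial.comp_aeval_apply (fun i => (⟨v i, hv i⟩ : L)) L.val g

open Polynomial in
theorem IntermediateField.aeval_map_mvPolynomial_aeval {k M σ : Type*} [Field k] [Field M]
    [Algebra k M] (L : IntermediateField k M) {v : σ → M} (hv : ∀ i, v i ∈ L)
    (h : Polynomial (MvPolynomial σ k)) (x : M) :
    aeval x (h.map (MvPolynomial.aeval (fun i => (⟨v i, hv i⟩ : L))).toRingHom) =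
      h.eval₂ (MvPolynomial.aeval v : MvPolynomial σ k →ₐ[k] M).toRingHom x := by
  rw [aeval_def, eval₂_map]
  congr 1
  exact RingHom.ext fun r => L.coe_mvPolynomial_aeval hv r

open Polynomial in
/-- If a product of polynomials `h(P(y))` is divisible by `f` over `A`, then every root of the
specialization of `f` by `ψ` gives a root of the specialization of some `h`. -/
theorem exists_eval₂_eq_zero_of_mul_eq_prod_comp {k Ω M σ : Type*} [Field k] [Field Ω]
    [Algebra k Ω] [Field M] [Algebra k M] {A : Subalgebra k Ω} {z : σ → Ω} (hz : ∀ i, z i ∈ A)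
    (ψ : A →ₐ[k] M) {s : Multiset (Polynomial (MvPolynomial σ k) × Polynomial Ω)}
    (hs : ∀ p ∈ s, p.2 ∈ lifts (algebraMap A Ω)) {f : Polynomial A} {w : Polynomial Ω}
    (hw : w ∈ lifts (algebraMap A Ω))
    (hfw : f.map (algebraMap A Ω) * w = (s.map fun p =>
      (p.1.map (MvPolynomial.aeval z : MvPolynomial σ k →ₐ[k] Ω).toRingHom).comp p.2).prod)
    {y : A} (hy : (f.map ψ.toRingHom).eval (ψ y) = 0) :
    ∃ p ∈ s, ∃ a : A, p.1.eval₂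
      (MvPolynomial.aeval fun i => ψ ⟨z i, hz i⟩ : MvPolynomial σ k →ₐ[k] M).toRingHom (ψ a) = 0 := by
  obtain ⟨w, rfl⟩ := (mem_lifts _).1 hw
  have hs' : ∀ p ∈ s, ∃ P : Polynomial A, P.map (algebraMap A Ω) = p.2 := fun p hp =>
    (mem_lifts _).1 (hs p hp)
  choose! P hP using hs'
  let ρ : MvPolynomial σ k →ₐ[k] A := MvPolynomial.aeval fun i => ⟨z i, hz i⟩
  have hρ : (algebraMap A Ω).comp ρ.toRingHom =
      (MvPolynomial.aeval z : MvPolynomial σ k →ₐ[k] Ω).toRingHom :=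
    RingHom.ext fun r => A.coe_mvPolynomial_aeval hz r
  have hψρ : ψ.toRingHom.comp ρ.toRingHom =
      (MvPolynomial.aeval fun i => ψ ⟨z i, hz i⟩ : MvPolynomial σ k →ₐ[k] M).toRingHom :=
    RingHom.ext fun r => MvPolynomial.comp_aeval_apply _ ψ r
  have hinj : Function.Injective (algebraMap A Ω) := Subtype.val_injective
  have hA : f * w = (s.map fun p : Polynomial (MvPolynomial σ k) × Polynomial Ω =>
      (p.1.map ρ.toRingHom).comp (P p)).prod := by
    apply Polynomial.map_injective _ hinj
    rw [Polynomial.map_mul, hfw, Polynomial.map_multiset_prod, Multiset.map_map]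
    congr 1
    refine Multiset.map_congr rfl fun p hp => ?_
    rw [Function.comp_apply, Polynomial.map_comp, Polynomial.map_map, hρ, hP p hp]
  have h0 : ψ (((s.map fun p : Polynomial (MvPolynomial σ k) × Polynomial Ω =>
      (p.1.map ρ.toRingHom).comp (P p)).prod).eval y) = 0 := by
    have : ψ (f.eval y) = 0 := by
      rw [← hy, eval_map]
      exact Polynomial.hom_eval₂ f (RingHom.id A) ψ.toRingHom y
    rw [← hA, eval_mul, map_mul, this, zero_mul]
  rw [eval_multiset_prod, map_multiset_prod, Multiset.map_map, Multiset.map_map,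
    Multiset.prod_eq_zero_iff] at h0
  obtain ⟨p, hp, hp0⟩ := Multiset.mem_map.1 h0
  refine ⟨p, hp, (P p).eval y, ?_⟩
  rw [← hψρ, ← hp0, Function.comp_apply, Function.comp_apply, eval_comp, eval_map]
  exact (Polynomial.hom_eval₂ p.1 ρ.toRingHom ψ.toRingHom _).symm

open Polynomial in
theorem Subalgebra.eval₂_mvPolynomial_aeval_eq_zero {k Ω M σ : Type*} [Field k] [Field Ω]
    [Algebra k Ω] [Field M] [Algebra k M] {A : Subalgebra k Ω} {z : σ → Ω} (hz : ∀ i, z i ∈ A)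
    (φ : A →ₐ[k] M) {η : Ω} (hη : η ∈ A) {e : Polynomial (MvPolynomial σ k)}
    (he : e.eval₂ (MvPolynomial.aeval z : MvPolynomial σ k →ₐ[k] Ω).toRingHom η = 0) :
    e.eval₂ (MvPolynomial.aeval fun i => φ ⟨z i, hz i⟩ : MvPolynomial σ k →ₐ[k] M).toRingHom
      (φ ⟨η, hη⟩) = 0 := by
  let ρ : MvPolynomial σ k →ₐ[k] A := MvPolynomial.aeval fun i => ⟨z i, hz i⟩
  have hρ : (algebraMap A Ω).comp ρ.toRingHom =
      (MvPolynomial.aeval z : MvPolynomial σ k →ₐ[k] Ω).toRingHom :=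
    RingHom.ext fun r => A.coe_mvPolynomial_aeval hz r
  have hφρ : φ.toRingHom.comp ρ.toRingHom =
      (MvPolynomial.aeval fun i => φ ⟨z i, hz i⟩ : MvPolynomial σ k →ₐ[k] M).toRingHom :=
    RingHom.ext fun r => MvPolynomial.comp_aeval_apply _ φ r
  have hA : e.eval₂ ρ.toRingHom (⟨η, hη⟩ : A) = 0 := by
    apply (Subtype.val_injective : Function.Injective (algebraMap A Ω))
    have h := Polynomial.hom_eval₂ e ρ.toRingHom (algebraMap A Ω) (⟨η, hη⟩ : A)
    rw [hρ] at h
    exact h.trans he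
  have h := Polynomial.hom_eval₂ e ρ.toRingHom φ.toRingHom (⟨η, hη⟩ : A)
  rw [hφρ, hA, map_zero] at h
  exact h.symm

section Specialization

variable {Ω : Type*} [Field Ω] [IsAlgClosed Ω] [CharZero Ω] {k : Type*} [Field k] [Algebra k Ω]
  {kbar : Type*} [Field kbar] [Algebra k kbar] [IsAlgClosure k kbar]
  {m : ℕ} {z : Fin m → Ω} {δ : MvPolynomial (Fin m) k} {η : Ω}

open Polynomial in
theorem aeval_specPoly (φ : Dalg k z δ η →ₐ[k] kbar) (h : Polynomial (MvPolynomial (Fin m) k))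
    (x : kbar) : aeval x (specPoly k kbar z δ η φ h) =
      h.eval₂ (MvPolynomial.aeval fun i => φ ⟨z i, z_mem k z δ η i⟩ :
        MvPolynomial (Fin m) k →ₐ[k] kbar).toRingHom x := by
  exact IntermediateField.aeval_map_mvPolynomial_aeval _ _ h x

theorem natDegree_specPoly {φ : Dalg k z δ η →ₐ[k] kbar}
    {h : Polynomial (MvPolynomial (Fin m) k)}
    (hφ : φ ⟨MvPolynomial.aeval z h.leadingCoeff, aeval_mem k z δ η _⟩ ≠ 0) :
    (specPoly k kbar z δ η φ h).natDegree = h.natDegree := by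
  refine Polynomial.natDegree_map_of_leadingCoeff_ne_zero _ fun h0 => hφ ?_
  rw [apply_mk_aeval, ← IntermediateField.coe_mvPolynomial_aeval]
  exact congrArg Subtype.val h0

theorem specPoly_ne_zero {φ : Dalg k z δ η →ₐ[k] kbar}
    {h : Polynomial (MvPolynomial (Fin m) k)}
    (hφ : φ ⟨MvPolynomial.aeval z h.leadingCoeff, aeval_mem k z δ η _⟩ ≠ 0) :
    specPoly k kbar z δ η φ h ≠ 0 := by
  refine fun hh => hφ ?_
  have h0 := congrArg (fun p => p.coeff h.natDegree) hh
  simp only [specPoly, Polynomial.coeff_map, Polynomial.coeff_zero] at h0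
  rw [apply_mk_aeval, ← IntermediateField.coe_mvPolynomial_aeval]
  exact congrArg Subtype.val h0

open Polynomial in
/-- Specializing an identity `f w = ∏ h(P(y))` shows that `φ(f)` has no root in `φ(D)`, provided
each `h` stays irreducible and has degree exceeding that of a polynomial annihilating `η`. -/
theorem eval_map_ne_zero_of_mul_eq_prod_comp (hδ : MvPolynomial.aeval z δ ≠ 0)
    {q : Dalg k z δ η} {φ : Dalg k z δ η →ₐ[k] kbar} (hφ : φ q ≠ 0)
    {ψ : Dadj k z δ η q →ₐ[k] kbar}
    (hψ : ψ.comp (Subalgebra.inclusion (le_Dadj k z δ η q)) = φ)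
    {e : Polynomial (MvPolynomial (Fin m) k)}
    (he : e.eval₂ (MvPolynomial.aeval z : MvPolynomial (Fin m) k →ₐ[k] Ω).toRingHom η = 0)
    (helc : φ ⟨MvPolynomial.aeval z e.leadingCoeff, aeval_mem k z δ η _⟩ ≠ 0)
    {s : Multiset (Polynomial (MvPolynomial (Fin m) k) × Polynomial Ω)}
    (hs : ∀ p ∈ s, e.natDegree < p.1.natDegree ∧
      φ ⟨MvPolynomial.aeval z p.1.leadingCoeff, aeval_mem k z δ η _⟩ ≠ 0 ∧
      Irreducible (specPoly k kbar z δ η φ p.1) ∧ p.2 ∈ lifts (algebraMap (Dadj k z δ η q) Ω))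
    {w : Polynomial Ω} (hw : w ∈ lifts (algebraMap (Dadj k z δ η q) Ω))
    {f : Polynomial (Dadj k z δ η q)}
    (hfw : f.map (algebraMap (Dadj k z δ η q) Ω) * w = (s.map fun p =>
      (p.1.map (MvPolynomial.aeval z : MvPolynomial (Fin m) k →ₐ[k] Ω).toRingHom).comp p.2).prod)
    (x : Dalg k z δ η) : (f.map ψ.toRingHom).eval (φ x) ≠ 0 := by
  intro h0
  have hψx : ∀ y : Dalg k z δ η, ψ ⟨y, le_Dadj k z δ η q y.2⟩ = φ y := fun y =>
    DFunLike.congr_fun hψ y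
  rw [← hψx] at h0
  obtain ⟨p, hp, a, hpa⟩ := exists_eval₂_eq_zero_of_mul_eq_prod_comp
    (fun i => le_Dadj k z δ η q (z_mem k z δ η i)) ψ (fun p hp => (hs p hp).2.2.2) hw hfw h0
  obtain ⟨hdeg, hlc, hirr, -⟩ := hs p hp
  obtain ⟨y, hy⟩ := extension_apply_mem_range hφ hψ a
  have hay : ψ a = φ y := hy.symm
  have hψz : (fun i => ψ ⟨z i, le_Dadj k z δ η q (z_mem k z δ η i)⟩) =
      fun i => φ ⟨z i, z_mem k z δ η i⟩ := funext fun i => hψx ⟨z i, z_mem k z δ η i⟩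
  rw [hψz, hay, ← aeval_specPoly] at hpa
  have heφ : aeval (φ ⟨η, Algebra.subset_adjoin (Or.inr (Or.inr rfl))⟩)
      (specPoly k kbar z δ η φ e) = 0 := by
    rw [aeval_specPoly]
    exact Subalgebra.eval₂_mvPolynomial_aeval_eq_zero (z_mem k z δ η) φ
      (Algebra.subset_adjoin (Or.inr (Or.inr rfl))) he
  have := natDegree_le_of_irreducible_of_mem_adjoin (apply_mem_adjoin hδ φ y)
    (specPoly_ne_zero helc) heφ hirr hpa
  rw [natDegree_specPoly hlc, natDegree_specPoly helc] at this
  omega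

end Specialization
theorem exists_polynomial_map_eq {k Ω : Type*} [Field k] [Field Ω] [Algebra k Ω] {F : Subfield Ω}
    {A : Subalgebra k Ω} {f : Polynomial F} (hf : ∀ n, (f.coeff n : Ω) ∈ A) :
    ∃ g : Polynomial A, g.map (algebraMap A Ω) = f.map F.subtype ∧
      ∀ n, g.coeff n = ⟨f.coeff n, hf n⟩ := by
  have h : f.map F.subtype ∈ Polynomial.lifts (algebraMap A Ω) :=
    (Polynomial.lifts_iff_coeff_lifts _).2 fun n => by
      rw [Polynomial.coeff_map]
      exact ⟨⟨_, hf n⟩, rfl⟩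
  obtain ⟨g, hg⟩ := (Polynomial.mem_lifts _).1 h
  refine ⟨g, hg, fun n => Subtype.ext ?_⟩
  have hn := congrArg (fun p => p.coeff n) hg
  simp only [Polynomial.coeff_map] at hn
  exact hn

/-- Corollary 2.12 of the paper. -/
theorem root_specialization
    {Ω : Type*} [Field Ω] [IsAlgClosed Ω] [CharZero Ω]
    (k : Type*) [Field k] [Algebra k Ω]
    (kbar : Type*) [Field kbar] [Algebra k kbar] [IsAlgClosure k kbar]
    {m : ℕ} (z : Fin m → Ω) (δ : MvPolynomial (Fin m) k) (η : Ω)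
    -- hypothesis (H)
    (hm : 0 < m) (hz : AlgebraicIndependent k z) (hδ : δ ≠ 0)
    (hη : IsIntegral ↥(Algebra.adjoin k (Set.range z ∪ {(MvPolynomial.aeval z δ)⁻¹})) η)
    (f : Polynomial ↥(Ffield k z δ η)) :
    ∃ (hs : Finset (Polynomial (MvPolynomial (Fin m) k))) (g : MvPolynomial (Fin m) k)
      (q : ↥(Dalg k z δ η)),
      (∀ h ∈ hs, Irreducible h ∧ 0 < h.natDegree) ∧ g ≠ 0 ∧ q ≠ 0 ∧
      -- every coefficient of `f` lies in `D[1/q] ⊆ F`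
      (Dadj k z δ η q : Set Ω) ⊆ (Ffield k z δ η : Set Ω) ∧
      ∃ hcoeff : ∀ n : ℕ, (f.coeff n : Ω) ∈ Dadj k z δ η q,
        ∀ d : ℕ, 0 < d → ∀ φ ∈ Hset k kbar z δ η d hs g,
          -- `φ(q) ≠ 0`
          φ q ≠ 0 ∧
          -- `φ` extends uniquely to `D[1/q]`
          (∃! ψ : ↥(Dadj k z δ η q) →ₐ[k] kbar,
            ψ.comp (Subalgebra.inclusion (le_Dadj k z δ η q)) = φ) ∧
          -- and, for the extension `ψ`: `φ(f)` has a root in the field `φ(D)` if and only if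
          -- `f` has a root in `F`
          ∀ ψ : ↥(Dadj k z δ η q) →ₐ[k] kbar,
            ψ.comp (Subalgebra.inclusion (le_Dadj k z δ η q)) = φ →
            ∃ fbar : Polynomial kbar,
              (∀ n : ℕ, fbar.coeff n = ψ ⟨(f.coeff n : Ω), hcoeff n⟩) ∧
              ((∃ x : ↥(Dalg k z δ η), fbar.eval (φ x) = 0) ↔
                (∃ r : ↥(Ffield k z δ η), f.eval r = 0)) := by
    classical
  let R := MvPolynomial (Fin m) k
  let K := FractionRing R
  let : Algebra R Ω := (MvPolynomial.aeval z).toAlgebra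
  have hR : ∀ r : R, algebraMap R Ω r = MvPolynomial.aeval z r := fun _ => rfl
  have : FaithfulSMul R Ω := (faithfulSMul_iff_algebraMap_injective R Ω).2 hz
  let : Algebra K Ω := FractionRing.liftAlgebra R Ω
  have : IsScalarTower R K Ω := FractionRing.isScalarTower_liftAlgebra R Ω
  have : CharZero k := (algebraMap k Ω).charZero
  have : CharZero K := charZero_of_injective_algebraMap (IsFractionRing.injective R K)
  have hηK : IsIntegral K η := isIntegral_of_isIntegral_adjoin hR hη
  have hz0 : ∀ g : R, g ≠ 0 → MvPolynomial.aeval z g ≠ 0 := fun g hg h =>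
    hg (hz (h.trans (map_zero _).symm))
  set fΩ : Polynomial Ω := f.map (Ffield k z δ η).subtype with hfΩ
  have hfc : ∀ n, fΩ.coeff n ∈ Ffield k z δ η := fun n => by
    rw [hfΩ, Polynomial.coeff_map]
    exact (f.coeff n).2
  have hlift : ∀ p : Polynomial Ω,
      p ∈ Polynomial.lifts (algebraMap (IntermediateField.adjoin K {η}) Ω) ↔
        ∀ n, p.coeff n ∈ Ffield k z δ η := fun p => by
    simp only [Polynomial.lifts_iff_coeff_lifts, mem_Ffield_iff (K := K) hR]
    simp
  by_cases hroot : ∃ r : Ffield k z δ η, f.eval r = 0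
  · obtain ⟨r, hr⟩ := hroot
    obtain ⟨g, hg0, hg⟩ := exists_forall_aeval_mul_coeff_mem_Dalg hR hηK
      {fΩ, Polynomial.C (r : Ω)} (by
        intro p hp n
        simp only [Multiset.insert_eq_cons, Multiset.mem_cons, Multiset.mem_singleton] at hp
        rcases hp with rfl | rfl
        · exact hfc n
        · rw [Polynomial.coeff_C]
          split_ifs
          exacts [r.2, zero_mem _])
    have hq0 : (⟨MvPolynomial.aeval z g, aeval_mem k z δ η g⟩ : Dalg k z δ η) ≠ 0 := fun h =>
      hz0 g hg0 (congrArg Subtype.val h)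
    have hcoeff : ∀ n, (f.coeff n : Ω) ∈ Dadj k z δ η ⟨_, aeval_mem k z δ η g⟩ := fun n =>
      mem_Dadj_of_mul_mem hq0 (by simpa [hfΩ] using hg fΩ (by simp) n)
    have hrD : (r : Ω) ∈ Dadj k z δ η ⟨_, aeval_mem k z δ η g⟩ :=
      mem_Dadj_of_mul_mem hq0 (by simpa using hg (Polynomial.C (r : Ω)) (by simp) 0)
    refine ⟨∅, g, ⟨_, aeval_mem k z δ η g⟩, by simp, hg0, hq0, Dadj_subset_Ffield _, hcoeff,
      fun d hd φ hφ => ⟨hφ.1, existsUnique_extension_Dadj φ hφ.1, fun ψ hψ => ?_⟩⟩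
    obtain ⟨fA, hfA, hfn⟩ := exists_polynomial_map_eq hcoeff
    refine ⟨fA.map ψ.toRingHom, fun n => ?_, iff_of_true ?_ ⟨r, hr⟩⟩
    · rw [Polynomial.coeff_map, hfn]
      rfl
    · obtain ⟨x, hx⟩ := extension_apply_mem_range hφ.1 hψ ⟨r, hrD⟩
      have hx' : φ x = ψ.toRingHom ⟨r, hrD⟩ := hx
      have hr0 : fA.eval ⟨r, hrD⟩ = 0 := by
        have h := Polynomial.eval₂_at_apply (p := fA)
          (algebraMap (Dadj k z δ η ⟨_, aeval_mem k z δ η g⟩) Ω) ⟨r, hrD⟩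
        rw [← Polynomial.eval_map, hfA, Polynomial.eval_map] at h
        exact Subtype.ext (h.symm.trans
          ((Polynomial.eval₂_at_apply (Ffield k z δ η).subtype r).trans
            (congrArg Subtype.val hr)))
      refine ⟨x, ?_⟩
      rw [hx', Polynomial.eval_map, Polynomial.eval₂_at_apply, hr0, map_zero]
  · have hroot' : ∀ x ∈ IntermediateField.adjoin K {η}, fΩ.eval x ≠ 0 := by
      intro x hx h
      refine hroot ⟨⟨x, (mem_Ffield_iff hR x).2 hx⟩, Subtype.ext ?_⟩
      rw [hfΩ, Polynomial.eval_map] at h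
      exact (Polynomial.eval₂_at_apply (Ffield k z δ η).subtype _).symm.trans h
    obtain ⟨e, he0, he, s, hs, w, hw, hfw⟩ :=
      exists_dvd_prod_comp_of_forall_eval_ne_zero (R := R) K hηK ((hlift _).2 hfc) hroot'
    obtain ⟨g, hg0, hg⟩ := exists_forall_aeval_mul_coeff_mem_Dalg hR hηK
      (fΩ ::ₘ w ::ₘ s.map Prod.snd) (by
        intro p hp n
        rw [Multiset.mem_cons, Multiset.mem_cons, Multiset.mem_map] at hp
        rcases hp with rfl | rfl | ⟨p, hp, rfl⟩
        · exact hfc n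
        · exact (hlift _).1 hw n
        · exact (hlift _).1 (hs p hp).2.2 n)
    let g' : R := g * (e.leadingCoeff * (s.map fun p => p.1.leadingCoeff).prod)
    have hg'0 : g' ≠ 0 := by
      refine mul_ne_zero hg0 (mul_ne_zero (Polynomial.leadingCoeff_ne_zero.2 he0) ?_)
      refine Multiset.prod_ne_zero fun h => ?_
      obtain ⟨p, hp, hp0⟩ := Multiset.mem_map.1 h
      exact (hs p hp).1.ne_zero (Polynomial.leadingCoeff_eq_zero.1 hp0)
    have hdvd : ∀ r : R, r ∣ g' → ∀ φ : Dalg k z δ η →ₐ[k] kbar,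
        φ ⟨MvPolynomial.aeval z g', aeval_mem k z δ η g'⟩ ≠ 0 →
        φ ⟨MvPolynomial.aeval z r, aeval_mem k z δ η r⟩ ≠ 0 := by
      rintro r ⟨t, ht⟩ φ h h0
      rw [apply_mk_aeval] at h h0
      rw [ht, map_mul, h0, zero_mul] at h
      exact h rfl
    have hq0 : (⟨MvPolynomial.aeval z g, aeval_mem k z δ η g⟩ : Dalg k z δ η) ≠ 0 := fun h =>
      hz0 g hg0 (congrArg Subtype.val h)
    have hmemA : ∀ p : Polynomial Ω, (∀ n, MvPolynomial.aeval z g * p.coeff n ∈ Dalg k z δ η) →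
        p ∈ Polynomial.lifts (algebraMap (Dadj k z δ η ⟨_, aeval_mem k z δ η g⟩) Ω) :=
      fun p hp => (Polynomial.lifts_iff_coeff_lifts p).2 fun n =>
        ⟨⟨_, mem_Dadj_of_mul_mem hq0 (hp n)⟩, rfl⟩
    have hcoeff : ∀ n, (f.coeff n : Ω) ∈ Dadj k z δ η ⟨_, aeval_mem k z δ η g⟩ := fun n =>
      mem_Dadj_of_mul_mem hq0 (by simpa [hfΩ] using hg fΩ (by simp) n)
    refine ⟨(s.map Prod.fst).toFinset, g', ⟨_, aeval_mem k z δ η g⟩, ?_, hg'0, hq0,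
      Dadj_subset_Ffield _, hcoeff, fun d hd φ hφ => ?_⟩
    · intro h hh
      obtain ⟨p, hp, rfl⟩ := Multiset.mem_map.1 (Multiset.mem_toFinset.1 hh)
      exact ⟨(hs p hp).1, (Nat.zero_le _).trans_lt (hs p hp).2.1⟩
    have hφq := hdvd g (dvd_mul_right _ _) φ hφ.1
    refine ⟨hφq, existsUnique_extension_Dadj φ hφq, fun ψ hψ => ?_⟩
    obtain ⟨fA, hfA, hfn⟩ := exists_polynomial_map_eq hcoeff
    refine ⟨fA.map ψ.toRingHom, fun n => ?_, iff_of_false ?_ hroot⟩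
    · rw [Polynomial.coeff_map, hfn]
      rfl
    · rintro ⟨x, hx⟩
      refine eval_map_ne_zero_of_mul_eq_prod_comp (hz0 δ hδ) hφq hψ he
        (hdvd _ (dvd_mul_of_dvd_right (dvd_mul_right _ _) _) φ hφ.1) (s := s) ?_
        (hmemA w (hg w (by simp))) (f := fA) ?_ x hx
      · intro p hp
        refine ⟨(hs p hp).2.1, hdvd _ ?_ φ hφ.1, (hφ.2.2 p.1 ?_).2, hmemA _ (hg _ ?_)⟩
        · exact dvd_mul_of_dvd_right (dvd_mul_of_dvd_right
            (Multiset.dvd_prod (Multiset.mem_map_of_mem _ hp)) _) _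
        · exact Multiset.mem_toFinset.2 (Multiset.mem_map_of_mem _ hp)
        · exact Multiset.mem_cons_of_mem (Multiset.mem_cons_of_mem (Multiset.mem_map_of_mem _ hp))
      · rw [hfA]
        exact hfw
end

section
/- Let K be a field of characteristic zero that is finitely generated over ℚ as a field extension, and let Γ be a finitely generated subgroup of the multiplicative group K^×. Then rad_K(Γ) is a finitely generated group. -/
/-- The radical `rad_K(Γ) = { α ∈ K^× : α^l ∈ Γ for some l > 0 }` of a subgroup `Γ` of `K^×`. -/
def Subgroup.radOf {K : Type*} [Field K] (Γ : Subgroup Kˣ) : Subgroup Kˣ where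
  carrier := { α : Kˣ | ∃ l : ℕ, 0 < l ∧ α ^ l ∈ Γ }
  one_mem' := ⟨1, Nat.one_pos, by simpa using Γ.one_mem⟩
  mul_mem' := by
    rintro a b ⟨l, hl, ha⟩ ⟨j, hj, hb⟩
    refine ⟨l * j, Nat.mul_pos hl hj, ?_⟩
    rw [mul_pow]
    exact Γ.mul_mem (by rw [pow_mul]; exact pow_mem ha j)
      (by rw [mul_comm l j, pow_mul]; exact pow_mem hb l)
  inv_mem' := by
    rintro a ⟨l, hl, ha⟩
    exact ⟨l, hl, by rw [inv_pow]; exact Γ.inv_mem ha⟩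

theorem CommGroup.subgroup_fg_iff {G : Type*} [CommGroup G] (H : Subgroup G) :
    H.FG ↔ (AddSubgroup.toIntSubmodule H.toAddSubgroup).FG := by
  rw [Submodule.fg_iff_addSubgroup_fg, AddSubgroup.toIntSubmodule_toAddSubgroup,
    Subgroup.fg_iff_add_fg]

theorem Subgroup.FG.of_le {G : Type*} [CommGroup G] {H H' : Subgroup G} (hH : H.FG)
    (h : H' ≤ H) : H'.FG := by
  rw [CommGroup.subgroup_fg_iff] at hH ⊢
  exact hH.of_le (AddSubgroup.toIntSubmodule.monotone (Subgroup.toAddSubgroup.monotone h))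

theorem Subgroup.FG.of_map_of_inf_ker {G G' : Type*} [CommGroup G] [CommGroup G'] (f : G →* G')
    {H : Subgroup G} (hmap : (H.map f).FG) (hker : (H ⊓ f.ker).FG) : H.FG := by
  rw [CommGroup.subgroup_fg_iff] at *
  exact Submodule.fg_of_fg_map_of_fg_inf_ker (MonoidHom.toAdditive f).toIntLinearMap hmap hker

theorem Subgroup.FG.comap_of_injective {G G' : Type*} [CommGroup G] [CommGroup G'] {f : G →* G'}
    (hf : Function.Injective f) {H : Subgroup G'} (hH : H.FG) : (H.comap f).FG := by
  rw [Subgroup.fg_iff_submonoid_fg]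
  refine Submonoid.FG.map_injective f hf ?_
  exact (Subgroup.fg_iff_submonoid_fg _).1 (hH.of_le (Subgroup.map_comap_le f H))

theorem Subgroup.FG.map {G G' : Type*} [Group G] [Group G'] (f : G →* G') {H : Subgroup G}
    (hH : H.FG) : (H.map f).FG := by
  rw [Subgroup.fg_iff_submonoid_fg] at hH ⊢
  exact Submonoid.FG.map hH f

theorem Subgroup.map_radOf_comap {K L : Type*} [Field K] [Field L] (f : Kˣ →* Lˣ)
    (Γ : Subgroup Lˣ) :
    (radOf (Γ.comap f)).map f = radOf Γ ⊓ f.range := by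
  ext x
  constructor
  · rintro ⟨y, ⟨l, hl, hy⟩, rfl⟩
    exact ⟨⟨l, hl, by simpa using hy⟩, y, rfl⟩
  · rintro ⟨⟨l, hl, hy⟩, y, rfl⟩
    exact ⟨y, ⟨l, hl, by simpa using hy⟩, rfl⟩

open IsDedekindDomain

theorem IsDedekindDomain.finite_valuationOfNeZero_ne_one {R K : Type*} [CommRing R]
    [IsDedekindDomain R] [Field K] [Algebra R K] [IsFractionRing R K] (x : Kˣ) :
    {v : HeightOneSpectrum R | v.valuationOfNeZero x ≠ 1}.Finite := by
  refine ((HeightOneSpectrum.Support.finite R (x : K)).union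
    (HeightOneSpectrum.Support.finite R (x⁻¹ : K))).subset fun v hv ↦ ?_
  have hv' : v.valuation K (x : K) ≠ 1 := by
    rw [← HeightOneSpectrum.valuationOfNeZero_eq]
    exact_mod_cast hv
  rcases hv'.lt_or_gt with h | h
  · right
    simpa [HeightOneSpectrum.Support] using (one_lt_inv₀ (by simp [zero_lt_iff])).2 h
  · exact .inl h

theorem IsDedekindDomain.iInf_ker_valuationOfNeZero_le {R K : Type*} [CommRing R]
    [IsDedekindDomain R] [Field K] [Algebra R K] [IsFractionRing R K] :
    ⨅ v : HeightOneSpectrum R, (v.valuationOfNeZero (K := K)).ker ≤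
      (Units.map (algebraMap R K : R →* K)).range := by
  intro x hx
  have hx1 (v : HeightOneSpectrum R) : v.valuation K (x : K) = 1 := by
    rw [← HeightOneSpectrum.valuationOfNeZero_eq]
    exact_mod_cast (Subgroup.mem_iInf.1 hx v)
  obtain ⟨a, ha⟩ := HeightOneSpectrum.mem_integers_of_valuation_le_one (R := R) K (x : K)
    fun v ↦ (hx1 v).le
  obtain ⟨b, hb⟩ := HeightOneSpectrum.mem_integers_of_valuation_le_one (R := R) K (x⁻¹ : K)
    fun v ↦ by simp [hx1 v]
  have hab : a * b = 1 := IsFractionRing.injective R K (by simp [ha, hb])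
  exact ⟨⟨a, b, hab, by rw [mul_comm, hab]⟩, Units.ext ha⟩

theorem IsDedekindDomain.fg_of_le_radOf (R : Type*) {K : Type*} [CommRing R] [IsDedekindDomain R]
    [Field K] [Algebra R K] [IsFractionRing R K] {Γ H : Subgroup Kˣ} (hΓ : Γ.FG)
    (hH : H ≤ Γ.radOf) (hR : (H ⊓ (Units.map (algebraMap R K : R →* K)).range).FG) : H.FG := by
  obtain ⟨s, rfl⟩ := hΓ
  let S : Set (HeightOneSpectrum R) := ⋃ g ∈ s, {v | v.valuationOfNeZero g ≠ 1}
  have : Finite S :=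
    (s.finite_toSet.biUnion fun g _ ↦ finite_valuationOfNeZero_ne_one g).to_subtype
  let f : Kˣ →* (S → Multiplicative ℤ) := MonoidHom.pi fun v ↦ v.1.valuationOfNeZero
  refine Subgroup.FG.of_map_of_inf_ker f ?_ (hR.of_le ?_)
  · rw [CommGroup.subgroup_fg_iff]
    have : IsNoetherian ℤ (Additive (S → Multiplicative ℤ)) :=
      inferInstanceAs (IsNoetherian ℤ (S → ℤ))
    exact IsNoetherian.noetherian _
  · refine le_inf inf_le_left (le_trans ?_ iInf_ker_valuationOfNeZero_le)
    rintro x ⟨hxH, hxf⟩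
    rw [Subgroup.mem_iInf]
    intro v
    by_cases hv : v ∈ S
    · exact congrFun hxf ⟨v, hv⟩
    · obtain ⟨l, hl, hx⟩ := hH hxH
      have hle : Subgroup.closure (s : Set Kˣ) ≤ v.valuationOfNeZero.ker := by
        rw [Subgroup.closure_le]
        intro g hg
        by_contra hgv
        exact hv (Set.mem_biUnion hg hgv)
      have := hle hx
      rw [MonoidHom.mem_ker, map_pow] at this
      exact (pow_eq_one_iff_left hl.ne').1 this

theorem NumberField.fg_radOf {K : Type*} [Field K] [NumberField K] {Γ : Subgroup Kˣ}
    (hΓ : Γ.FG) : Γ.radOf.FG := by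
  refine IsDedekindDomain.fg_of_le_radOf (NumberField.RingOfIntegers K) hΓ le_rfl
    (Subgroup.FG.of_le ?_ inf_le_right)
  rw [MonoidHom.range_eq_map]
  exact Subgroup.FG.map _ (Group.fg_def.1 (Group.fg_iff_monoid_fg.2 inferInstance))

theorem RingHom.IsIntegralElem.of_range_le {A B K : Type*} [CommRing A] [CommRing B] [CommRing K]
    {f : A →+* K} {g : B →+* K} (hfg : f.range ≤ g.range) {a : K} (ha : f.IsIntegralElem a) :
    g.IsIntegralElem a := by
  obtain ⟨p, hp, hpa⟩ := ha
  have hlifts : p.map f ∈ Polynomial.lifts g := by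
    rw [Polynomial.lifts_iff_coeff_lifts]
    intro n
    rw [Polynomial.coeff_map]
    exact hfg ⟨_, rfl⟩
  obtain ⟨q, hq, -, hqm⟩ := Polynomial.lifts_and_natDegree_eq_and_monic hlifts (hp.map f)
  exact ⟨q, hqm, by rw [← Polynomial.eval_map, hq, Polynomial.eval_map, hpa]⟩

theorem isIntegral_of_isIntegral_adjoin_inv {k K : Type*} [Field k] [Field K] [Algebra k K]
    {x a : K} (h : IsIntegral (Algebra.adjoin k {x}) a)
    (h' : IsIntegral (Algebra.adjoin k {x⁻¹}) a) : IsIntegral k a := by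
  have key (V : ValuationSubring K) (hV : Set.range (algebraMap k K) ⊆ V.toSubring) (y : K)
      (hy : y ∈ V) (ha : IsIntegral (Algebra.adjoin k {y}) a) : a ∈ V := by
    have hle : (algebraMap (Algebra.adjoin k {y}) K).range ≤ (algebraMap V K).range := by
      rintro _ ⟨⟨z, hz⟩, rfl⟩
      refine ⟨⟨z, ?_⟩, rfl⟩
      induction hz using Algebra.adjoin_induction with
      | mem z hz => rwa [hz]
      | algebraMap r => exact hV ⟨r, rfl⟩
      | add _ _ _ _ h₁ h₂ => exact V.add_mem _ _ h₁ h₂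
      | mul _ _ _ _ h₁ h₂ => exact V.mul_mem _ _ h₁ h₂
    obtain ⟨b, rfl⟩ := IsIntegrallyClosed.isIntegral_iff.1
      (show IsIntegral V a from RingHom.IsIntegralElem.of_range_le hle ha)
    exact b.2
  have ha : a ∈ (integralClosure (Subring.closure (Set.range (algebraMap k K))) K).toSubring := by
    rw [← iInf_valuationSubring_superset, Subring.mem_iInf]
    rintro ⟨V, hV⟩
    exact (V.mem_or_inv_mem x).elim (key V hV x · h) (key V hV _ · h')
  refine RingHom.IsIntegralElem.of_range_le ?_ ha
  rintro _ ⟨z, rfl⟩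
  exact (Subring.closure_le (t := (algebraMap k K).range)).2 (fun _ h ↦ h) z.2

open scoped IntermediateField.algebraAdjoinAdjoin IntermediateField in
theorem Transcendental.finite_algebraicClosure {k K : Type*} [Field k] [Field K] [Algebra k K]
    {x : K} (hx : Transcendental k x) [FiniteDimensional k⟮x⟯ K] :
    FiniteDimensional k (algebraicClosure k K) := by
  let b : Module.Basis ℕ k (Algebra.adjoin k {x}) := (Polynomial.basisMonomials k).map
    (Polynomial.algEquivOfTranscendental k x hx).toLinearEquiv
  have hdisj : (algebraicClosure k K).toSubalgebra.LinearDisjoint (Algebra.adjoin k {x}) := by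
    refine .of_basis_right _ _ b ?_
    have := (Polynomial.basisMonomials (algebraicClosure k K)).linearIndependent.map'
      (Polynomial.aeval (R := algebraicClosure k K) x).toLinearMap
      (LinearMap.ker_eq_bot.2 (transcendental_iff_injective.1 hx.algebraicClosure))
    convert! this using 1
    ext n
    simp [b, Polynomial.algEquivOfTranscendental]
  let c := Module.Basis.ofVectorSpace k (algebraicClosure k K)
  have hc := hdisj.linearIndependent_left_of_flat c.linearIndependent
  rw [LinearIndependent.iff_fractionRing (Algebra.adjoin k {x}) k⟮x⟯] at hc
  have := hc.finite
  exact Module.Finite.of_basis c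

open scoped IntermediateField.algebraAdjoinAdjoin IntermediateField in
theorem Transcendental.fg_of_le_radOf {k K : Type*} [Field k] [CharZero k] [Field K] [Algebra k K]
    {x : K} (hx : Transcendental k x) [FiniteDimensional k⟮x⟯ K] {Γ H : Subgroup Kˣ}
    (hΓ : Γ.FG) (hH : H ≤ Γ.radOf)
    (hR : (H ⊓ (Units.map
      (algebraMap (integralClosure (Algebra.adjoin k {x}) K) K).toMonoidHom).range).FG) : H.FG := by
  have : IsPrincipalIdealRing (Algebra.adjoin k {x}) :=
    .of_surjective (Polynomial.algEquivOfTranscendental k x hx)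
      (Polynomial.algEquivOfTranscendental k x hx).surjective
  have := integralClosure.isDedekindDomain (Algebra.adjoin k {x}) k⟮x⟯ (L := K)
  have := integralClosure.isFractionRing_of_finite_extension (A := Algebra.adjoin k {x}) k⟮x⟯ K
  exact IsDedekindDomain.fg_of_le_radOf _ hΓ hH hR

open scoped IntermediateField in
theorem Transcendental.fg_radOf {k K : Type*} [Field k] [CharZero k] [Field K] [Algebra k K]
    {x : K} (hx : Transcendental k x) [FiniteDimensional k⟮x⟯ K]
    (hk : ∀ Γ : Subgroup (algebraicClosure k K)ˣ, Γ.FG → Γ.radOf.FG)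
    {Γ : Subgroup Kˣ} (hΓ : Γ.FG) : Γ.radOf.FG := by
  have hx' : Transcendental k x⁻¹ := mt IsAlgebraic.inv_iff.1 hx
  have hadj : k⟮x⁻¹⟯ = k⟮x⟯ := by
    refine le_antisymm ?_ ?_ <;> rw [IntermediateField.adjoin_simple_le_iff]
    · exact inv_mem (IntermediateField.mem_adjoin_simple_self k x)
    · exact inv_mem_iff.1 (IntermediateField.mem_adjoin_simple_self k x⁻¹)
  have : FiniteDimensional k⟮x⁻¹⟯ K := hadj ▸ ‹FiniteDimensional k⟮x⟯ K›
  let f : (algebraicClosure k K)ˣ →* Kˣ :=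
    Units.map (algebraMap (algebraicClosure k K) K).toMonoidHom
  have hf : Function.Injective f :=
    Units.map_injective (algebraMap (algebraicClosure k K) K).injective
  refine hx.fg_of_le_radOf hΓ le_rfl (hx'.fg_of_le_radOf hΓ inf_le_left ?_)
  refine Subgroup.FG.of_le ((hk _ (hΓ.comap_of_injective hf)).map f) ?_
  rw [Subgroup.map_radOf_comap]
  rintro _ ⟨⟨hu, a, rfl⟩, b, hb⟩
  refine ⟨hu, ?_⟩
  have hint : IsIntegral k ((a : integralClosure (Algebra.adjoin k {x}) K) : K) := by
    refine isIntegral_of_isIntegral_adjoin_inv a.1.2 ?_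
    have hab : ((b : integralClosure (Algebra.adjoin k {x⁻¹}) K) : K) = (a.1 : K) :=
      congrArg Units.val hb
    rw [← hab]
    exact b.1.2
  have hmem : (a.1 : K) ∈ algebraicClosure k K := mem_algebraicClosure_iff.2 hint.isAlgebraic
  refine ⟨Units.mk0 ⟨a.1, hmem⟩ fun h ↦ ?_, Units.ext rfl⟩
  exact (Units.map (algebraMap _ K).toMonoidHom a).ne_zero (congrArg Subtype.val h)

open scoped IntermediateField in
theorem exists_transcendental_finiteDimensional {F K : Type*} [Field F] [Field K] [Algebra F K]
    [Algebra.EssFiniteType F K] [Algebra.Transcendental F K] :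
    ∃ (k : IntermediateField F K) (x : K), k.FG ∧ Transcendental k x ∧
      FiniteDimensional k⟮x⟯ K := by
  obtain ⟨s, hs⟩ := exists_finset_isTranscendenceBasis F K
  obtain ⟨x⟩ := hs.nonempty_iff_transcendental.2 ‹_›
  have himg : ((↑) : s → K) '' {x}ᶜ = (s : Set K) \ {x.1} := by
    ext; aesop
  let k := IntermediateField.adjoin F ((s : Set K) \ {x.1})
  have hxk : Transcendental k x.1 := by
    rw [IntermediateField.transcendental_adjoin_iff, ← himg]
    exact hs.1.transcendental_adjoin (by simp)
  have : Algebra.EssFiniteType k K := .of_comp F _ K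
  have : Algebra.EssFiniteType k⟮x.1⟯ K := .of_comp k _ K
  have : Algebra.IsAlgebraic k⟮x.1⟯ K := by
    have h := hs.isAlgebraic_field
    have heq : k⟮x.1⟯.restrictScalars F =
        IntermediateField.adjoin F (Set.range ((↑) : s → K)) := by
      rw [IntermediateField.adjoin_adjoin_left, Set.sdiff_union_of_subset (by simp)]
      simp
    rw [← heq] at h
    exact h
  exact ⟨k, x, IntermediateField.fg_adjoin_of_finite (s.finite_toSet.sdiff), hxk,
    Algebra.finite_of_essFiniteType_of_isAlgebraic⟩

theorem fg_radOf_of_trdeg_eq (n : ℕ) : ∀ (K : Type*) [Field K] [CharZero K]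
    [Algebra.EssFiniteType ℚ K], Algebra.trdeg ℚ K = n →
    ∀ Γ : Subgroup Kˣ, Γ.FG → Γ.radOf.FG := by
  induction n using Nat.strong_induction_on with
  | _ n ih =>
  intro K _ _ _ hn Γ hΓ
  by_cases halg : Algebra.IsAlgebraic ℚ K
  · have : FiniteDimensional ℚ K := Algebra.finite_of_essFiniteType_of_isAlgebraic
    have : NumberField K := ⟨⟩
    exact NumberField.fg_radOf hΓ
  · have : Algebra.Transcendental ℚ K := Algebra.transcendental_iff_not_isAlgebraic.2 halg
    obtain ⟨k, x, hk, hx, hfin⟩ := exists_transcendental_finiteDimensional (F := ℚ) (K := K)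
    have : Algebra.EssFiniteType ℚ k := IntermediateField.essFiniteType_iff.2 hk
    have := hx.finite_algebraicClosure
    have : Algebra.EssFiniteType ℚ (algebraicClosure k K) := .comp ℚ k _
    have hadd := trdeg_add_eq ℚ (algebraicClosure k K) (A := K)
    have hpos : 0 < Algebra.trdeg (algebraicClosure k K) K := by
      have : Algebra.Transcendental (algebraicClosure k K) K := ⟨x, hx.algebraicClosure⟩
      exact trdeg_pos _ _
    obtain ⟨m, hm⟩ := Cardinal.lt_aleph0.1 (trdeg_lt_aleph0 ℚ (algebraicClosure k K))
    refine hx.fg_radOf (ih m ?_ _ hm) hΓ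
    have : Algebra.EssFiniteType (algebraicClosure k K) K := .of_comp ℚ _ K
    obtain ⟨l, hl⟩ := Cardinal.lt_aleph0.1 (trdeg_lt_aleph0 (algebraicClosure k K) K)
    rw [hn, hm, hl] at hadd
    rw [hl] at hpos
    norm_cast at hadd hpos
    lia

/-- Proposition 2.16 of the paper. -/
theorem rad_fg_of_finitelyGenerated
    (K : Type*) [Field K] [CharZero K]
    (hK : ∃ s : Finset K, IntermediateField.adjoin ℚ (s : Set K) = ⊤)
    (Γ : Subgroup Kˣ) (hΓ : Γ.FG) : (Subgroup.radOf Γ).FG := by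
  have : Algebra.EssFiniteType ℚ K := IntermediateField.fg_top_iff.1 hK
  obtain ⟨n, hn⟩ := Cardinal.lt_aleph0.1 (trdeg_lt_aleph0 ℚ K)
  exact fg_radOf_of_trdeg_eq n K hn Γ hΓ
end

section
/- Assume hypothesis (H). Let Γ be a finitely generated subgroup of the group of units of D that is radical in F (i.e., every α ∈ F^× with α^l ∈ Γ for some integer l > 0 lies in Γ), and let ℓ be a positive integer. For a group H write H_ℓ = {h ∈ H : h^ℓ = 1}. Then there exist a finite set 𝐟 of irreducible polynomials in k[z,y] ∖ k[z] and a nonzero g ∈ k[z] such that for every positive integer d and every φ ∈ ℋ_D(d,𝐟,g): φ(Γ) is a finitely generated subgroup of the group of units of φ(D), and φ(Γ_ℓ) = (φ(Γ))_ℓ. -/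
set_option linter.unusedSectionVars false
set_option linter.unusedVariables false

/-- A ring homomorphism to an algebraically closed field extends along an integral extension. -/
theorem RingHom.exists_extension_of_isIntegral {R S M : Type*} [CommRing R] [CommRing S] [Field M]
    [IsAlgClosed M] [Algebra R S] [Algebra.IsIntegral R S] (φ : R →+* M)
    (hker : RingHom.ker (algebraMap R S) ≤ RingHom.ker φ) :
    ∃ ψ : S →+* M, ∀ r, ψ (algebraMap R S r) = φ r := by
  have hP : (RingHom.ker φ).IsPrime := RingHom.ker_isPrime φ
  obtain ⟨Q, -, hQ, hQP⟩ := Ideal.exists_ideal_over_prime_of_isIntegral (S := S)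
    (RingHom.ker φ) ⊥ hker
  have : Q.LiesOver (RingHom.ker φ) := ⟨hQP.symm⟩
  let _ : Algebra (R ⧸ RingHom.ker φ) M := (RingHom.kerLift φ).toAlgebra
  have : FaithfulSMul (R ⧸ RingHom.ker φ) M :=
    (faithfulSMul_iff_algebraMap_injective _ _).2 (RingHom.kerLift_injective φ)
  have : Algebra.IsIntegral (R ⧸ RingHom.ker φ) (S ⧸ Q) :=
    Ideal.Quotient.algebra_isIntegral_of_liesOver Q (RingHom.ker φ)
  have : IsDomain (R ⧸ RingHom.ker φ) := Ideal.Quotient.isDomain _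
  have : IsDomain (S ⧸ Q) := Ideal.Quotient.isDomain _
  have : Module.IsTorsionFree (R ⧸ RingHom.ker φ) (S ⧸ Q) :=
    Module.isTorsionFree_iff_faithfulSMul.2 (Ideal.Quotient.instFaithfulSMul Q (RingHom.ker φ))
  have : Module.IsTorsionFree (R ⧸ RingHom.ker φ) M :=
    Module.isTorsionFree_iff_faithfulSMul.2 inferInstance
  let ψ : S ⧸ Q →ₐ[R ⧸ RingHom.ker φ] M := IsAlgClosed.lift
  refine ⟨(ψ : S ⧸ Q →+* M).comp (Ideal.Quotient.mk Q), fun r => ?_⟩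
  exact ψ.commutes (Ideal.Quotient.mk _ r)

/-- Denominators can be cleared in an algebra generated over a fraction field. -/
theorem IsFractionRing.exists_smul_mem_adjoin {A K L : Type*} [CommRing A] [IsDomain A] [Field K]
    [Field L] [Algebra A K] [IsFractionRing A K] [Algebra A L] [Algebra K L]
    [IsScalarTower A K L] {S : Set L} {x : L} (hx : x ∈ Algebra.adjoin K S) :
    ∃ a : A, a ≠ 0 ∧ a • x ∈ Algebra.adjoin A S := by
  induction hx using Algebra.adjoin_induction with
  | mem x hx => exact ⟨1, one_ne_zero, by simpa using Algebra.subset_adjoin hx⟩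
  | algebraMap r =>
    obtain ⟨a, b, hb, rfl⟩ := IsFractionRing.div_surjective (A := A) r
    have hb0 : b ≠ 0 := nonZeroDivisors.ne_zero hb
    have hbK : algebraMap A K b ≠ 0 := by simpa using hb0
    refine ⟨b, hb0, ?_⟩
    have : b • algebraMap K L (algebraMap A K a / algebraMap A K b) = algebraMap A L a := by
      rw [Algebra.smul_def, IsScalarTower.algebraMap_apply A K L, ← map_mul,
        mul_div_cancel₀ _ hbK, IsScalarTower.algebraMap_apply A K L]
    rw [this]
    exact Subalgebra.algebraMap_mem _ a
  | add x y _ _ hx hy =>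
    obtain ⟨a, ha, hax⟩ := hx
    obtain ⟨b, hb, hby⟩ := hy
    refine ⟨a * b, mul_ne_zero ha hb, ?_⟩
    rw [smul_add, mul_comm a b, mul_smul, mul_comm b a, mul_smul]
    exact add_mem (Subalgebra.smul_mem _ hax b) (Subalgebra.smul_mem _ hby a)
  | mul x y _ _ hx hy =>
    obtain ⟨a, ha, hax⟩ := hx
    obtain ⟨b, hb, hby⟩ := hy
    refine ⟨a * b, mul_ne_zero ha hb, ?_⟩
    rw [← smul_mul_smul_comm]
    exact mul_mem hax hby

open IntermediateField in
/-- A primitive element chosen integral over the base ring and inside the algebra generated by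
the given elements. -/
theorem IsFractionRing.exists_isIntegral_primitive_element {A K L : Type*} [CommRing A] [IsDomain A]
    [IsIntegrallyClosed A] [Field K] [CharZero K] [Field L] [Algebra A K] [IsFractionRing A K]
    [Algebra A L] [Algebra K L] [IsScalarTower A K L] (x y : L)
    (hx : IsIntegral A x) (hy : IsIntegral A y) :
    ∃ θ ∈ Algebra.adjoin A {x, y}, IsIntegral A θ ∧
      (minpoly A θ).natDegree = Module.finrank K K⟮x, y⟯ := by
  have hint : ∀ s ∈ ({x, y} : Set L), IsIntegral K s := by
    rintro s (rfl | rfl)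
    · exact hx.tower_top
    · exact hy.tower_top
  have : FiniteDimensional K K⟮x, y⟯ :=
    finiteDimensional_adjoin hint
  obtain ⟨θ, hθ⟩ : ∃ θ : L, K⟮θ⟯ = K⟮x, y⟯ := by
    obtain ⟨θ, hθ⟩ := Field.exists_primitive_element K K⟮x, y⟯
    refine ⟨θ, ?_⟩
    rw [← lift_adjoin_simple, hθ, lift_top]
  have hmem : θ ∈ Algebra.adjoin K ({x, y} : Set L) := by
    rw [← adjoin_toSubalgebra_of_isAlgebraic fun s hs => (hint s hs).isAlgebraic,
      mem_toSubalgebra, ← hθ]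
    exact mem_adjoin_simple_self K θ
  obtain ⟨a, ha, haθ⟩ := IsFractionRing.exists_smul_mem_adjoin (A := A) hmem
  have hintA : Algebra.IsIntegral A (Algebra.adjoin A ({x, y} : Set L)) :=
    Algebra.IsIntegral.adjoin (by
      rintro s (rfl | rfl)
      · exact hx
      · exact hy)
  have hI : IsIntegral A (a • θ) :=
    (hintA.isIntegral ⟨a • θ, haθ⟩).map (Algebra.adjoin A ({x, y} : Set L)).val
  refine ⟨a • θ, haθ, hI, ?_⟩
  have haK : algebraMap A K a ≠ 0 := by simpa using ha
  have h1 : K⟮a • θ⟯ = K⟮x, y⟯ := by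
    rw [← hθ, ← algebraMap_smul K a]
    apply le_antisymm
    · rw [adjoin_simple_le_iff]
      exact smul_mem _ (mem_adjoin_simple_self K _)
    · rw [adjoin_simple_le_iff]
      have := smul_mem _ (x := (algebraMap A K a)⁻¹)
        (mem_adjoin_simple_self K (algebraMap A K a • θ))
      rwa [inv_smul_smul₀ haK] at this
  rw [← h1, adjoin.finrank hI.tower_top, minpoly.isIntegrallyClosed_eq_field_fractions' K hI,
    (minpoly.monic hI).natDegree_map]

section Specialization

open IntermediateField Polynomial

variable {Ω : Type*} [Field Ω] [IsAlgClosed Ω] [CharZero Ω]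
variable {k : Type*} [Field k] [Algebra k Ω]
variable {kbar : Type*} [Field kbar] [Algebra k kbar] [IsAlgClosure k kbar]
variable {m : ℕ} {z : Fin m → Ω} {δ : MvPolynomial (Fin m) k} {η : Ω}

/-- The base field `k(φ(z₁),…,φ(z_m))` of the specialized polynomials contains the values of `φ`
on polynomials in `z`. -/
theorem map_aeval_mem_adjoin (φ : ↥(Dalg k z δ η) →ₐ[k] kbar) (g : MvPolynomial (Fin m) k) :
    φ ⟨MvPolynomial.aeval z g, aeval_mem k z δ η g⟩ ∈
      IntermediateField.adjoin k (Set.range fun i => φ ⟨z i, z_mem k z δ η i⟩) := by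
  have h : (⟨MvPolynomial.aeval z g, aeval_mem k z δ η g⟩ : ↥(Dalg k z δ η)) =
      MvPolynomial.aeval (fun i => (⟨z i, z_mem k z δ η i⟩ : ↥(Dalg k z δ η))) g := by
    apply Subtype.ext
    change _ = (Dalg k z δ η).val _
    rw [MvPolynomial.comp_aeval_apply]
    rfl
  rw [h, MvPolynomial.comp_aeval_apply]
  apply algebra_adjoin_le_adjoin
  rw [Algebra.adjoin_range_eq_range_aeval]
  exact ⟨g, rfl⟩

/-- A root of a polynomial specializes to a root of the specialized polynomial. -/
theorem aeval_specPoly_eq_zero (φ : ↥(Dalg k z δ η) →ₐ[k] kbar)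
    {S : Subalgebra ↥(Dalg k z δ η) Ω} (ψ : S →+* kbar)
    (hψ : ∀ r, ψ (algebraMap ↥(Dalg k z δ η) S r) = φ r)
    (f : Polynomial (MvPolynomial (Fin m) k)) (θ : S)
    (hθ : f.eval₂ (MvPolynomial.aeval z).toRingHom (θ : Ω) = 0) :
    aeval (ψ θ) (specPoly k kbar z δ η φ f) = 0 := by
  let c : MvPolynomial (Fin m) k →+* S := (algebraMap ↥(Dalg k z δ η) S).comp
    (MvPolynomial.aeval (fun i => (⟨z i, z_mem k z δ η i⟩ : ↥(Dalg k z δ η)))).toRingHom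
  have hc : S.val.toRingHom.comp c = (MvPolynomial.aeval z).toRingHom := by
    apply MvPolynomial.ringHom_ext
    · intro r
      simp [c]
    · intro i
      simp [c]
  have h0 : f.eval₂ c θ = 0 := by
    apply Subtype.val_injective
    change S.val.toRingHom _ = S.val.toRingHom 0
    rw [hom_eval₂, hc, map_zero]
    exact hθ
  have h1 := congrArg ψ h0
  rw [hom_eval₂, map_zero] at h1
  rw [specPoly, aeval_def, eval₂_map, ← h1]
  congr 1
  apply MvPolynomial.ringHom_ext
  · intro r
    simp [c, hψ]
  · intro i
    simp [c, hψ]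

/-- If an integral element `θ` of `D[ζ]` has a larger degree than an integral element generating
`D` up to denominators, and its equation stays irreducible under the specialization `φ`, then
`φ(D)` contains no primitive `n`-th root of unity. -/
theorem not_isPrimitiveRoot_specialization (hδ : MvPolynomial.aeval z δ ≠ 0)
    (φ : ↥(Dalg k z δ η) →ₐ[k] kbar)
    (a : MvPolynomial (Fin m) k) (ha : φ ⟨MvPolynomial.aeval z a, aeval_mem k z δ η a⟩ ≠ 0)
    {p q : Polynomial (MvPolynomial (Fin m) k)} (hp : p.Monic) (hq : q.Monic)
    (hpx : p.eval₂ (MvPolynomial.aeval z).toRingHom (MvPolynomial.aeval z a * η) = 0)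
    (hpq : p.natDegree < q.natDegree) (hirr : Irreducible (specPoly k kbar z δ η φ q))
    {n : ℕ} (hn : 0 < n) {ζ : Ω} (hζ : IsPrimitiveRoot ζ n) {θ : Ω}
    (hθ : θ ∈ Algebra.adjoin ↥(Dalg k z δ η) {ζ})
    (hqθ : q.eval₂ (MvPolynomial.aeval z).toRingHom θ = 0)
    (y : ↥(Dalg k z δ η)) : ¬ IsPrimitiveRoot (φ y) n := by
  intro hy
  have := IsAlgClosure.isAlgClosed k (K := kbar)
  have : NeZero n := ⟨hn.ne'⟩
  have hηD : η ∈ Dalg k z δ η := Algebra.subset_adjoin (by simp)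
  have hδD : (MvPolynomial.aeval z δ)⁻¹ ∈ Dalg k z δ η := Algebra.subset_adjoin (by simp)
  let D := Dalg k z δ η
  set L₀ := IntermediateField.adjoin k (Set.range fun i => φ ⟨z i, z_mem k z δ η i⟩) with hL₀
  let aD : D := ⟨MvPolynomial.aeval z a, aeval_mem k z δ η a⟩
  let ηD : D := ⟨η, hηD⟩
  set L₁ : IntermediateField L₀ kbar := L₀⟮φ (aD * ηD)⟯ with hL₁
  have hL₀₁ : ∀ t ∈ L₀, t ∈ L₁ := fun t ht => L₁.algebraMap_mem ⟨t, ht⟩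
  have hφL : ∀ t : D, φ t ∈ L₁ := by
    rintro ⟨t, ht⟩
    refine Algebra.adjoin_induction (p := fun t ht => φ (⟨t, ht⟩ : D) ∈ L₁)
      ?_ ?_ ?_ ?_ ht
    · rintro t (⟨i, rfl⟩ | rfl | rfl)
      · exact hL₀₁ _ (IntermediateField.subset_adjoin k _ ⟨i, rfl⟩)
      · have h1 : φ ⟨(MvPolynomial.aeval z δ)⁻¹, hδD⟩ *
            φ ⟨MvPolynomial.aeval z δ, aeval_mem k z δ η δ⟩ = 1 := by
          rw [← map_mul, ← map_one φ]
          congr 1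
          exact Subtype.ext (inv_mul_cancel₀ hδ)
        rw [eq_inv_of_mul_eq_one_left h1]
        exact hL₀₁ _ (inv_mem (map_aeval_mem_adjoin φ δ))
      · have h1 : φ ηD = (φ aD)⁻¹ * φ (aD * ηD) := by
          rw [map_mul, inv_mul_cancel_left₀ ha]
        change φ ηD ∈ L₁
        rw [h1]
        exact mul_mem (hL₀₁ _ (inv_mem (map_aeval_mem_adjoin φ a))) (mem_adjoin_simple_self _ _)
    · intro r
      have : φ (⟨algebraMap k Ω r, D.algebraMap_mem r⟩ : D) = algebraMap k kbar r := φ.commutes r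
      rw [this]
      exact hL₀₁ _ (L₀.algebraMap_mem r)
    · intro s t hs ht ihs iht
      exact (map_add φ (⟨s, hs⟩ : D) (⟨t, ht⟩ : D)) ▸ add_mem ihs iht
    · intro s t hs ht ihs iht
      exact (map_mul φ (⟨s, hs⟩ : D) (⟨t, ht⟩ : D)) ▸ mul_mem ihs iht
  have hζint : IsIntegral D ζ := by
    refine ⟨X ^ n - 1, monic_X_pow_sub_C (1 : D) hn.ne', ?_⟩
    simp [hζ.pow_eq_one]
  have hS : Algebra.IsIntegral D (Algebra.adjoin D ({ζ} : Set Ω)) :=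
    Algebra.IsIntegral.adjoin (by rintro _ rfl; exact hζint)
  obtain ⟨ψ, hψ⟩ := RingHom.exists_extension_of_isIntegral
    (S := Algebra.adjoin D ({ζ} : Set Ω)) (φ : D →+* kbar) (by
      intro t ht
      have : t = 0 := Subtype.ext (congrArg
        (Subtype.val : Algebra.adjoin D ({ζ} : Set Ω) → Ω) (RingHom.mem_ker.1 ht))
      rw [this]
      exact zero_mem _)
  have hψζ : ψ ⟨ζ, Algebra.self_mem_adjoin_singleton D ζ⟩ ∈ L₁ := by
    obtain ⟨i, -, hi⟩ := hy.eq_pow_of_pow_eq_one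
      (ξ := ψ ⟨ζ, Algebra.self_mem_adjoin_singleton D ζ⟩) (by
        rw [← map_pow, ← map_one ψ]
        congr 1
        exact Subtype.ext hζ.pow_eq_one)
    rw [← hi]
    exact pow_mem (hφL y) i
  have hψL : ψ ⟨θ, hθ⟩ ∈ L₁ := by
    refine Algebra.adjoin_induction
      (p := fun t ht => ψ (⟨t, ht⟩ : Algebra.adjoin D ({ζ} : Set Ω)) ∈ L₁) ?_ ?_ ?_ ?_ hθ
    · rintro _ rfl
      exact hψζ
    · intro r
      have : ψ ⟨algebraMap D Ω r, Subalgebra.algebraMap_mem _ r⟩ = φ r := hψ r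
      rw [this]
      exact hφL r
    · intro s t hs ht ihs iht
      exact (ψ.map_add ⟨s, hs⟩ ⟨t, ht⟩) ▸ add_mem ihs iht
    · intro s t hs ht ihs iht
      exact (ψ.map_mul ⟨s, hs⟩ ⟨t, ht⟩) ▸ mul_mem ihs iht
  have hx : IsIntegral L₀ (φ (aD * ηD)) ∧ Module.finrank L₀ L₁ ≤ p.natDegree := by
    have hroot : aeval (φ (aD * ηD)) (specPoly k kbar z δ η φ p) = 0 := by
      have h1 : φ (aD * ηD) = ψ (algebraMap D _ (aD * ηD)) := (hψ _).symm
      rw [h1]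
      exact aeval_specPoly_eq_zero φ ψ hψ p _ hpx
    have hpm : (specPoly k kbar z δ η φ p).Monic := hp.map _
    have hint : IsIntegral L₀ (φ (aD * ηD)) := ⟨_, hpm, hroot⟩
    refine ⟨hint, ?_⟩
    rw [hL₁, adjoin.finrank hint]
    exact (natDegree_le_of_dvd (minpoly.dvd _ _ hroot) hpm.ne_zero).trans natDegree_map_le
  have hmin : specPoly k kbar z δ η φ q = minpoly L₀ (ψ ⟨θ, hθ⟩) :=
    minpoly.eq_of_irreducible_of_monic hirr (aeval_specPoly_eq_zero φ ψ hψ q ⟨θ, hθ⟩ hqθ)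
      (hq.map _)
  have hdeg : (minpoly L₀ (ψ ⟨θ, hθ⟩)).natDegree = q.natDegree := by
    rw [← hmin]
    exact hq.natDegree_map _
  have : FiniteDimensional L₀ L₁ := adjoin.finiteDimensional hx.1
  have hle := minpoly.natDegree_le (A := L₀) (⟨ψ ⟨θ, hθ⟩, hψL⟩ : L₁)
  rw [← minpoly.algebraMap_eq (algebraMap L₁ kbar).injective] at hle
  change (minpoly L₀ (ψ ⟨θ, hθ⟩)).natDegree ≤ _ at hle
  omega

/-- Some multiple `a(z) η` with `a ≠ 0` is integral over `k[z]`, with a monic equation `p` such that,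
for every root of unity `ζ`, some element of `D[ζ]` has an irreducible monic equation over `k[z]`,
of degree larger than that of `p` if `ζ` is not in the field of fractions of `D`. -/
theorem exists_minpoly_natDegree_lt (hz : AlgebraicIndependent k z)
    (hη : IsIntegral ↥(Algebra.adjoin k (Set.range z ∪ {(MvPolynomial.aeval z δ)⁻¹})) η) :
    ∃ (a : MvPolynomial (Fin m) k) (p : Polynomial (MvPolynomial (Fin m) k)),
      a ≠ 0 ∧ p.Monic ∧
      p.eval₂ (MvPolynomial.aeval z).toRingHom (MvPolynomial.aeval z a * η) = 0 ∧
      ∀ (n : ℕ) (ζ : Ω), 0 < n → ζ ^ n = 1 →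
        ∃ (q : Polynomial (MvPolynomial (Fin m) k)) (θ : Ω), Irreducible q ∧ 0 < q.natDegree ∧
          q.Monic ∧ θ ∈ Algebra.adjoin ↥(Dalg k z δ η) {ζ} ∧
          q.eval₂ (MvPolynomial.aeval z).toRingHom θ = 0 ∧
          (ζ ∉ Ffield k z δ η → p.natDegree < q.natDegree) := by
  let _ : Algebra (MvPolynomial (Fin m) k) Ω := (MvPolynomial.aeval z).toRingHom.toAlgebra
  have : FaithfulSMul (MvPolynomial (Fin m) k) Ω :=
    (faithfulSMul_iff_algebraMap_injective _ _).2 hz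
  let A := MvPolynomial (Fin m) k
  let K := FractionRing A
  let _ : Algebra K Ω := FractionRing.liftAlgebra A Ω
  have : IsScalarTower A K Ω := FractionRing.isScalarTower_liftAlgebra A Ω
  have : CharZero k := (algebraMap k Ω).charZero
  have : CharZero K := (algebraMap K Ω).charZero
  have hηK : IsIntegral K η := by
    have hC : ∀ c ∈ Algebra.adjoin k (Set.range z ∪ {(MvPolynomial.aeval z δ)⁻¹}),
        c ∈ (algebraMap K Ω).range := by
      have hA : ∀ g : A, MvPolynomial.aeval z g ∈ (algebraMap K Ω).range := fun g =>
        ⟨algebraMap A K g, (IsScalarTower.algebraMap_apply A K Ω g).symm⟩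
      intro c hc
      induction hc using Algebra.adjoin_induction with
      | mem t ht =>
        rcases ht with ⟨i, rfl⟩ | rfl
        · simpa using hA (MvPolynomial.X i)
        · obtain ⟨b, hb⟩ := hA δ
          exact ⟨b⁻¹, by rw [map_inv₀, hb]⟩
      | algebraMap r => simpa using hA (MvPolynomial.C r)
      | add s t _ _ hs ht => exact add_mem hs ht
      | mul s t _ _ hs ht => exact mul_mem hs ht
    let e : K ≃+* (algebraMap K Ω).range := RingEquiv.ofBijective (algebraMap K Ω).rangeRestrict
      ⟨fun x y h => (algebraMap K Ω).injective (congrArg Subtype.val h),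
        (algebraMap K Ω).rangeRestrict_surjective⟩
    refine IsIntegral.map_of_comp_eq ((e.symm : _ →+* K).comp
      (Subring.inclusion (S := (Algebra.adjoin k
        (Set.range z ∪ {(MvPolynomial.aeval z δ)⁻¹})).toSubring) hC)) (RingHom.id Ω) ?_ hη
    ext c
    exact congrArg Subtype.val (e.apply_symm_apply ⟨c, hC c c.2⟩)
  obtain ⟨a, ha, hax⟩ : ∃ a : A, a ≠ 0 ∧ IsIntegral A (a • η) :=
    ((IsFractionRing.isAlgebraic_iff A K Ω).2 hηK.isAlgebraic).exists_integral_multiple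
  have hF : ∀ t ∈ K⟮a • η⟯, t ∈ Ffield k z δ η := by
    have hD : ∀ t ∈ Dalg k z δ η, t ∈ Ffield k z δ η := fun t ht => Subfield.subset_closure ht
    let E : IntermediateField K Ω :=
      (Ffield k z δ η).toIntermediateField (by
        intro r
        obtain ⟨b, c, -, rfl⟩ := IsFractionRing.div_surjective (A := A) r
        rw [map_div₀, ← IsScalarTower.algebraMap_apply, ← IsScalarTower.algebraMap_apply]
        exact div_mem (hD _ (aeval_mem k z δ η b)) (hD _ (aeval_mem k z δ η c)))
    have : K⟮a • η⟯ ≤ E := by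
      rw [adjoin_simple_le_iff]
      change a • η ∈ Ffield k z δ η
      rw [Algebra.smul_def]
      exact mul_mem (hD _ (aeval_mem k z δ η a)) (hD _ (Algebra.subset_adjoin (by simp)))
    exact this
  refine ⟨a, minpoly A (a • η), ha, minpoly.monic hax, ?_, ?_⟩
  · change eval₂ _ (algebraMap A Ω a * η) _ = 0
    rw [← Algebra.smul_def]
    exact minpoly.aeval A (a • η)
  intro n ζ hn hζ
  have hζI : IsIntegral A ζ :=
    ⟨X ^ n - 1, monic_X_pow_sub_C (1 : A) hn.ne', by simp [hζ]⟩
  obtain ⟨θ, hθ, hθI, hdeg⟩ :=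
    IsFractionRing.exists_isIntegral_primitive_element (K := K) (a • η) ζ hax hζI
  refine ⟨minpoly A θ, θ, minpoly.irreducible hθI, minpoly.natDegree_pos hθI, minpoly.monic hθI,
    ?_, minpoly.aeval A θ, ?_⟩
  · have hD : ∀ t ∈ Dalg k z δ η, t ∈ Algebra.adjoin ↥(Dalg k z δ η) {ζ} := fun t ht =>
      Subalgebra.algebraMap_mem _ (⟨t, ht⟩ : Dalg k z δ η)
    clear hθI hdeg
    induction hθ using Algebra.adjoin_induction with
    | mem t ht =>
      rcases ht with rfl | rfl
      · rw [Algebra.smul_def]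
        exact mul_mem (hD _ (aeval_mem k z δ η a)) (hD _ (Algebra.subset_adjoin (by simp)))
      · exact Algebra.self_mem_adjoin_singleton _ _
    | algebraMap r => exact hD _ (aeval_mem k z δ η r)
    | add s t _ _ hs ht => exact add_mem hs ht
    | mul s t _ _ hs ht => exact mul_mem hs ht
  · intro hζF
    have hfin : FiniteDimensional K K⟮a • η, ζ⟯ :=
      finiteDimensional_adjoin (by
        rintro s (rfl | rfl)
        · exact hax.tower_top
        · exact hζI.tower_top)
    have h1 : (minpoly A (a • η)).natDegree = Module.finrank K K⟮a • η⟯ := by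
      rw [adjoin.finrank hax.tower_top, minpoly.isIntegrallyClosed_eq_field_fractions' K hax,
        (minpoly.monic hax).natDegree_map]
    rw [h1, hdeg]
    by_contra! hle
    have h2 : K⟮a • η⟯ = K⟮a • η, ζ⟯ :=
      eq_of_le_of_finrank_le (adjoin.mono _ _ _ (by simp)) hle
    refine hζF (hF ζ ?_)
    rw [h2]
    exact subset_adjoin _ _ (by simp)

end Specialization

/-- Lemma 2.18 of the paper. Under hypothesis (H), let `Γ` be a finitely
generated subgroup of the group of units of `D` which is radical in `F`, and let `ℓ > 0`.
Then there exist a finite set `𝐟` of irreducible polynomials in `k[z,y] ∖ k[z]` and a nonzero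
`g ∈ k[z]` such that for every `d > 0` and every `φ ∈ ℋ_D(d,𝐟,g)`, `φ(Γ)` is a finitely
generated subgroup of the group of units of `φ(D)` and `φ(Γ_ℓ) = (φ(Γ))_ℓ`. -/
theorem torsion_specialization
    {Ω : Type*} [Field Ω] [IsAlgClosed Ω] [CharZero Ω]
    (k : Type*) [Field k] [Algebra k Ω]
    (kbar : Type*) [Field kbar] [Algebra k kbar] [IsAlgClosure k kbar]
    {m : ℕ} (z : Fin m → Ω) (δ : MvPolynomial (Fin m) k) (η : Ω)
    -- hypothesis (H)
    (hm : 0 < m) (hz : AlgebraicIndependent k z) (hδ : δ ≠ 0)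
    (hη : IsIntegral ↥(Algebra.adjoin k (Set.range z ∪ {(MvPolynomial.aeval z δ)⁻¹})) η)
    -- `Γ` is a finitely generated subgroup of the group of units of `D` …
    (Γ : Subgroup Ωˣ) (hΓfg : Γ.FG)
    (hΓD : ∀ u : Ωˣ, u ∈ Γ → (u : Ω) ∈ Dalg k z δ η)
    -- … which is radical in `F`
    (hrad : ∀ α : Ωˣ, (α : Ω) ∈ Ffield k z δ η →
      ∀ l : ℕ, 0 < l → α ^ l ∈ Γ → α ∈ Γ)
    (ℓ : ℕ) (hℓ : 0 < ℓ) :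
    ∃ (fs : Finset (Polynomial (MvPolynomial (Fin m) k))) (g : MvPolynomial (Fin m) k),
      (∀ f ∈ fs, Irreducible f ∧ 0 < f.natDegree) ∧ g ≠ 0 ∧
      ∀ d : ℕ, 0 < d → ∀ φ ∈ Hset k kbar z δ η d fs g,
        -- `φ(Γ)` consists of invertible elements of `φ(D)` …
        (∀ (u : Ωˣ) (hu : u ∈ Γ), φ ⟨(u : Ω), hΓD u hu⟩ ≠ 0) ∧
        -- … and is a finitely generated subgroup of `k̄ˣ`
        (∃ Γ' : Subgroup kbarˣ, Γ'.FG ∧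
          Units.val '' (Γ' : Set kbarˣ)
            = { y : kbar | ∃ (u : Ωˣ) (hu : u ∈ Γ), y = φ ⟨(u : Ω), hΓD u hu⟩ }) ∧
        -- `φ(Γ_ℓ) = (φ(Γ))_ℓ`
        { y : kbar | ∃ (u : Ωˣ) (hu : u ∈ Γ), u ^ ℓ = 1 ∧ y = φ ⟨(u : Ω), hΓD u hu⟩ }
          = { y : kbar |
              (∃ (u : Ωˣ) (hu : u ∈ Γ), y = φ ⟨(u : Ω), hΓD u hu⟩) ∧ y ^ ℓ = 1 } := by
  classical
  have hδ' : MvPolynomial.aeval z δ ≠ 0 := fun h => hδ (hz (by rw [h, map_zero]))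
  have : CharZero k := (algebraMap k Ω).charZero
  have : CharZero kbar := charZero_of_injective_algebraMap (algebraMap k kbar).injective
  obtain ⟨a, p, ha, hp, hpx, hq⟩ := exists_minpoly_natDegree_lt hz hη
  have hex : ∀ n : ℕ, 0 < n → ∃ (ζ : Ω) (q : Polynomial (MvPolynomial (Fin m) k)) (θ : Ω),
      IsPrimitiveRoot ζ n ∧ Irreducible q ∧ 0 < q.natDegree ∧
          q.Monic ∧ θ ∈ Algebra.adjoin ↥(Dalg k z δ η) {ζ} ∧
          q.eval₂ (MvPolynomial.aeval z).toRingHom θ = 0 ∧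
          (ζ ∉ Ffield k z δ η → p.natDegree < q.natDegree) := by
    intro n hn
    have : NeZero n := ⟨hn.ne'⟩
    obtain ⟨ζ, hζ⟩ := HasEnoughRootsOfUnity.exists_primitiveRoot Ω n
    obtain ⟨q, θ, h⟩ := hq n ζ hn hζ.pow_eq_one
    exact ⟨ζ, q, θ, hζ, h⟩
  choose! ζ q θ hζ hqirr hqdeg hqm hθ hqθ hlt using hex
  refine ⟨ℓ.divisors.image q, a, ?_, ha, ?_⟩
  · intro f hf
    obtain ⟨n, hn, rfl⟩ := Finset.mem_image.1 hf
    have := Nat.pos_of_mem_divisors hn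
    exact ⟨hqirr n this, hqdeg n this⟩
  rintro d - φ ⟨hφa, -, hφf⟩
  let Φ : Γ →* kbar :=
    { toFun := fun u => φ ⟨((u : Ωˣ) : Ω), hΓD u u.2⟩
      map_one' := map_one φ
      map_mul' := fun u v => map_mul φ (⟨((u : Ωˣ) : Ω), hΓD u u.2⟩ : Dalg k z δ η)
        ⟨((v : Ωˣ) : Ω), hΓD v v.2⟩ }
  have hΦ : ∀ (u : Ωˣ) (hu : u ∈ Γ), φ ⟨(u : Ω), hΓD u hu⟩ = Φ.toHomUnits ⟨u, hu⟩ :=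
    fun u hu => (MonoidHom.coe_toHomUnits Φ ⟨u, hu⟩).symm
  refine ⟨fun u hu => hΦ u hu ▸ Units.ne_zero _, ⟨Φ.toHomUnits.range, ?_, ?_⟩, ?_⟩
  · have : Group.FG Γ := (Group.fg_iff_subgroup_fg Γ).2 hΓfg
    exact (Group.fg_iff_subgroup_fg _).1 inferInstance
  · ext y
    constructor
    · rintro ⟨_, ⟨⟨u, hu⟩, rfl⟩, rfl⟩
      exact ⟨u, hu, (hΦ u hu).symm⟩
    · rintro ⟨u, hu, rfl⟩
      exact ⟨_, ⟨⟨u, hu⟩, rfl⟩, (hΦ u hu).symm⟩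
  ext y
  constructor
  · rintro ⟨u, hu, huℓ, rfl⟩
    refine ⟨⟨u, hu, rfl⟩, ?_⟩
    rw [hΦ u hu, ← Units.val_pow_eq_pow_val, ← map_pow]
    have : (⟨u, hu⟩ : Γ) ^ ℓ = 1 := Subtype.ext huℓ
    rw [this, map_one, Units.val_one]
  rintro ⟨⟨u, hu, rfl⟩, hy⟩
  set y := φ ⟨(u : Ω), hΓD u hu⟩
  have hn : orderOf y ∣ ℓ := orderOf_dvd_of_pow_eq_one hy
  have hn0 : 0 < orderOf y := Nat.pos_of_dvd_of_pos hn hℓ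
  have hyprim : IsPrimitiveRoot y (orderOf y) := IsPrimitiveRoot.orderOf y
  generalize orderOf y = n at hn hn0 hyprim
  have : NeZero n := ⟨hn0.ne'⟩
  have hζF : ζ n ∈ Ffield k z δ η := by
    by_contra hζF
    exact not_isPrimitiveRoot_specialization hδ' φ a hφa hp (hqm n hn0) hpx (hlt n hn0 hζF)
      (hφf _ (Finset.mem_image_of_mem q (Nat.mem_divisors.2 ⟨hn, hℓ.ne'⟩))).2 hn0 (hζ n hn0)
      (hθ n hn0) (hqθ n hn0) _ hyprim
  obtain ⟨v, hv⟩ := (hζ n hn0).isUnit hn0.ne'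
  have hvn : v ^ n = 1 := Units.ext (by
    rw [Units.val_pow_eq_pow_val, hv, (hζ n hn0).pow_eq_one, Units.val_one])
  have hvΓ : v ∈ Γ := hrad v (hv ▸ hζF) n hn0 (hvn ▸ Γ.one_mem)
  have hvprim : IsPrimitiveRoot (φ ⟨(v : Ω), hΓD v hvΓ⟩) n := by
    have h1 : IsPrimitiveRoot (⟨(v : Ω), hΓD v hvΓ⟩ : Dalg k z δ η) n :=
      IsPrimitiveRoot.of_map_of_injective (f := (Dalg k z δ η).val) (by
        have := hζ n hn0
        rwa [← hv] at this) Subtype.val_injective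
    have : NeZero ((n : ℕ) : Dalg k z δ η) :=
      ⟨fun h => hn0.ne' (by
        have := congrArg (Dalg k z δ η).val h
        simpa using this)⟩
    have : NeZero ((n : ℕ) : kbar) := ⟨Nat.cast_ne_zero.2 hn0.ne'⟩
    have h2 := (Polynomial.isRoot_cyclotomic_iff.2 h1).map (f := (φ : Dalg k z δ η →+* kbar))
    rw [Polynomial.map_cyclotomic] at h2
    exact Polynomial.isRoot_cyclotomic_iff.1 h2
  obtain ⟨i, -, hi⟩ := hvprim.eq_pow_of_pow_eq_one hyprim.pow_eq_one
  refine ⟨v ^ i, Γ.pow_mem hvΓ i, ?_, ?_⟩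
  · obtain ⟨c, rfl⟩ := hn
    rw [← pow_mul, mul_comm, mul_assoc, pow_mul, hvn, one_pow]
  · rw [← hi, ← map_pow]
    congr 1
end

section
/- Assume hypothesis (H) and that k is finitely generated over ℚ as a field. Let Γ be a finitely generated subgroup of the group of units of D. Then there exist a finite set 𝐟 of irreducible polynomials in k[z,y] ∖ k[z] and a nonzero g ∈ k[z] such that for every positive integer d, ℋ_D(d,𝐟,g) ⊆ ℬ(D,Γ). -/
set_option linter.unusedSectionVars false
set_option linter.unusedVariables false

set_option linter.unusedSectionVars false
set_option linter.unusedVariables false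

section Base

variable {Ω : Type*} [Field Ω] [IsAlgClosed Ω] [CharZero Ω]
variable (k : Type*) [Field k] [Algebra k Ω]
variable (kbar : Type*) [Field kbar] [Algebra k kbar] [IsAlgClosure k kbar]

/-- `Γ` is (the carrier set of) a finitely generated subgroup of the additive group `(Ω,+)`
or of the multiplicative group `(Ω∖{0},·)`. -/
def IsFGAddOrMulSubgroup (Γ : Set Ω) : Prop :=
  (∃ H : AddSubgroup Ω, H.FG ∧ Γ = (H : Set Ω)) ∨
  (∃ H : Subgroup Ωˣ, H.FG ∧ Γ = Units.val '' (H : Set Ωˣ))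

/-- The `D`-subalgebra `D[Γ]` of `Ω` generated by `Γ`. -/
def algAdj (D : Subalgebra k Ω) (Γ : Set Ω) : Subalgebra k Ω :=
  Algebra.adjoin k ((D : Set Ω) ∪ Γ)

theorem le_algAdj (D : Subalgebra k Ω) (Γ : Set Ω) : D ≤ algAdj k D Γ :=
  fun _ hx => Algebra.subset_adjoin (Set.mem_union_left _ hx)

theorem subset_algAdj (D : Subalgebra k Ω) (Γ : Set Ω) :
    Γ ⊆ (algAdj k D Γ : Set Ω) :=
  fun _ hx => Algebra.subset_adjoin (Set.mem_union_right _ hx)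

/-- `ℬ(D,Γ)`: restrictions to `D` of the `k`-homomorphisms `D[Γ] → k̄` injective on `Γ`. -/
def specB (D : Subalgebra k Ω) (Γ : Set Ω) : Set (↥D →ₐ[k] kbar) :=
  { φ | ∃ ψ : ↥(algAdj k D Γ) →ₐ[k] kbar,
      (∀ (a b : Ω) (ha : a ∈ Γ) (hb : b ∈ Γ),
        ψ ⟨a, subset_algAdj k D Γ ha⟩ = ψ ⟨b, subset_algAdj k D Γ hb⟩ → a = b) ∧
      ψ.comp (Subalgebra.inclusion (le_algAdj k D Γ)) = φ }

/-- A basic open subset of `Hom_k(D,k̄)`: a finite intersection of sets `ℬ(D,Γ)`. -/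
def IsBasicOpen (D : Subalgebra k Ω) (U : Set (↥D →ₐ[k] kbar)) : Prop :=
  ∃ s : Finset (Set Ω), s.Nonempty ∧ (∀ Γ ∈ s, IsFGAddOrMulSubgroup Γ) ∧
    U = ⋂ Γ ∈ s, specB k kbar D Γ

/-- The Zariski closed subset `𝒱(I)` of `Hom_k(D,k̄)`. -/
def specV (D : Subalgebra k Ω) (I : Ideal ↥D) : Set (↥D →ₐ[k] kbar) :=
  { φ | ∀ a ∈ I, φ a = 0 }

/-- Density in the Zariski topology on `Hom_k(D,k̄)` (whose closed sets are the `𝒱(I)`). -/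
def ZariskiDense (D : Subalgebra k Ω) (U : Set (↥D →ₐ[k] kbar)) : Prop :=
  ∀ I : Ideal ↥D, U ⊆ specV k kbar D I → specV k kbar D I = Set.univ

end Base

open Polynomial
open scoped IntermediateField.algebraAdjoinAdjoin

/-- `T` represents the elements of `Q ∩ U` modulo squares of `U`. -/
def IsSquareCover {G : Type*} [CommGroup G] (U : Subgroup G) (Q : Set G) (T : Finset G) : Prop :=
  (∀ t ∈ T, t ∈ U ∧ t ∈ Q) ∧ ∀ x ∈ U, x ∈ Q → ∃ t ∈ T, ∃ y ∈ U, x = t * y ^ 2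

theorem exists_isSquareCover_of_relations {G : Type*} [CommGroup G] (U : Subgroup G)
    {Q Q' : Set G} {T : Finset G} (hT : IsSquareCover U Q T) (hQ : Q ⊆ Q')
    (hmul : ∀ x ∈ Q', ∀ y ∈ Q', x * y ∈ Q')
    (hrel : ∀ g ∈ U, g ∈ Q' → ∀ h ∈ U, h ∈ Q' →
      ∃ c d : ℤ, (Odd c ∨ Odd d) ∧ g ^ c * h ^ d ∈ Q) :
    ∃ T' : Finset G, IsSquareCover U Q' T' := by
  classical
  by_cases hall : ∀ x ∈ U, x ∈ Q' → ∃ t ∈ T, ∃ y ∈ U, x = t * y ^ 2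
  · exact ⟨T, fun t ht => ⟨(hT.1 t ht).1, hQ (hT.1 t ht).2⟩, hall⟩
  push Not at hall
  obtain ⟨h, hU, hQh, hne⟩ := hall
  refine ⟨T ∪ T.image (h * ·), ?_, ?_⟩
  · intro t ht
    rcases Finset.mem_union.1 ht with ht | ht
    · exact ⟨(hT.1 t ht).1, hQ (hT.1 t ht).2⟩
    · obtain ⟨s, hs, rfl⟩ := Finset.mem_image.1 ht
      exact ⟨U.mul_mem hU (hT.1 s hs).1, hmul _ hQh _ (hQ (hT.1 s hs).2)⟩
  intro g hg hgQ
  obtain ⟨c, d, hcd, hmem⟩ := hrel g hg hgQ h hU hQh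
  obtain ⟨t, ht, y, hy, hty⟩ := hT.2 _ (U.mul_mem (U.zpow_mem hg c) (U.zpow_mem hU d)) hmem
  rcases Int.even_or_odd d with ⟨d', rfl⟩ | ⟨d', rfl⟩
  · obtain ⟨c', rfl⟩ : Odd c := hcd.resolve_right (by simp)
    refine ⟨t, Finset.mem_union_left _ ht, y * (g ^ c')⁻¹ * (h ^ d')⁻¹,
      U.mul_mem (U.mul_mem hy (U.inv_mem (U.zpow_mem hg _))) (U.inv_mem (U.zpow_mem hU _)), ?_⟩
    rw [mul_pow, mul_pow, ← mul_assoc, ← mul_assoc, ← hty, two_mul, zpow_add, zpow_add, zpow_add,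
      zpow_one]
    generalize g ^ c' = a
    generalize h ^ d' = b
    rw [eq_comm, inv_pow, inv_pow, mul_inv_eq_iff_eq_mul, mul_inv_eq_iff_eq_mul, sq, sq]
    ac_rfl
  · rcases Int.even_or_odd c with ⟨c', rfl⟩ | ⟨c', rfl⟩
    · refine absurd ?_ (hne t ht (y * (g ^ c')⁻¹ * (h ^ d')⁻¹)
        (U.mul_mem (U.mul_mem hy (U.inv_mem (U.zpow_mem hg _))) (U.inv_mem (U.zpow_mem hU _))))
      rw [mul_pow, mul_pow, ← mul_assoc, ← mul_assoc, ← hty, two_mul, zpow_add, zpow_add,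
        zpow_add, zpow_one]
      generalize g ^ c' = a
      generalize h ^ d' = b
      rw [eq_comm, inv_pow, inv_pow, mul_inv_eq_iff_eq_mul, mul_inv_eq_iff_eq_mul, sq, sq]
      ac_rfl
    · refine ⟨h * t, Finset.mem_union_right _ (Finset.mem_image_of_mem _ ht),
        y * (g ^ c')⁻¹ * (h ^ d')⁻¹ * h⁻¹,
        U.mul_mem (U.mul_mem (U.mul_mem hy (U.inv_mem (U.zpow_mem hg _)))
          (U.inv_mem (U.zpow_mem hU _))) (U.inv_mem hU), ?_⟩
      rw [mul_pow, mul_pow, mul_pow, mul_assoc h t, ← mul_assoc t, ← mul_assoc t, ← mul_assoc t,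
        ← hty, two_mul, two_mul, zpow_add, zpow_add, zpow_add, zpow_add,
        zpow_one, zpow_one]
      generalize g ^ c' = a
      generalize h ^ d' = b
      rw [eq_comm, ← mul_assoc, inv_pow, inv_pow, inv_pow, mul_inv_eq_iff_eq_mul,
        ← mul_assoc, mul_inv_eq_iff_eq_mul,
        ← mul_assoc, mul_inv_eq_iff_eq_mul, sq, sq, sq]
      ac_rfl

/-- The elements having some power with exponent `2 ^ j` in `A`. -/
def twoSaturation {G : Type*} [CommGroup G] (A : Subgroup G) : Set G :=
  {x | ∃ j : ℕ, x ^ 2 ^ j ∈ A}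

theorem pow_mem_of_le {G : Type*} [CommGroup G] {A : Subgroup G} {x : G} {i j : ℕ}
    (h : x ^ 2 ^ i ∈ A) (hij : i ≤ j) : x ^ 2 ^ j ∈ A := by
  obtain ⟨l, rfl⟩ := Nat.exists_eq_add_of_le hij
  rw [pow_add, pow_mul]
  exact A.pow_mem h _

theorem mul_mem_twoSaturation {G : Type*} [CommGroup G] {A : Subgroup G} {x y : G}
    (hx : x ∈ twoSaturation A) (hy : y ∈ twoSaturation A) : x * y ∈ twoSaturation A := by
  obtain ⟨i, hi⟩ := hx
  obtain ⟨j, hj⟩ := hy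
  refine ⟨max i j, ?_⟩
  rw [mul_pow]
  exact A.mul_mem (pow_mem_of_le hi (le_max_left _ _)) (pow_mem_of_le hj (le_max_right _ _))

theorem inv_mem_twoSaturation {G : Type*} [CommGroup G] {A : Subgroup G} {x : G}
    (hx : x ∈ twoSaturation A) : x⁻¹ ∈ twoSaturation A := by
  obtain ⟨j, hj⟩ := hx
  exact ⟨j, by simpa using hj⟩

theorem mem_twoSaturation_of_sq {G : Type*} [CommGroup G] {A : Subgroup G} {x : G}
    (hx : x ^ 2 ∈ twoSaturation A) : x ∈ twoSaturation A := by
  obtain ⟨j, hj⟩ := hx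
  exact ⟨j + 1, by rwa [pow_succ', pow_mul]⟩

theorem exists_odd_relation (a b : ℤ) : ∃ c d : ℤ, (Odd c ∨ Odd d) ∧ a * c + b * d = 0 := by
  by_cases hg : Int.gcd a b = 0
  · obtain ⟨rfl, rfl⟩ := Int.gcd_eq_zero_iff.1 hg
    exact ⟨1, 0, Or.inl odd_one, by simp⟩
  obtain ⟨a', b', hco, ha, hb⟩ := Int.exists_gcd_one (Nat.pos_of_ne_zero hg)
  refine ⟨b', -a', ?_, by linear_combination b' * ha - a' * hb⟩
  by_contra! hodd
  rw [Int.not_odd_iff_even, Int.not_odd_iff_even, even_neg] at hodd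
  have h2 : (2 : ℤ) ∣ Int.gcd a' b' := Int.dvd_coe_gcd hodd.2.two_dvd hodd.1.two_dvd
  rw [hco] at h2
  norm_num at h2

theorem exists_isSquareCover_twoSaturation {Ω : Type*} [Field Ω] (U : Subgroup Ωˣ)
    (S : Finset Ωˣ) :
    ∃ T : Finset Ωˣ, IsSquareCover U (twoSaturation (Subgroup.closure (S : Set Ωˣ))) T := by
  classical
  induction S using Finset.induction_on with
  | empty =>
    rw [Finset.coe_empty, Subgroup.closure_empty]
    have h1 : IsSquareCover U ({1} : Set Ωˣ) {1} := by
      refine ⟨?_, ?_⟩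
      · simp [U.one_mem]
      · rintro x - rfl
        exact ⟨1, by simp, 1, U.one_mem, by simp⟩
    refine exists_isSquareCover_of_relations U h1 ?_ (fun x hx y hy => mul_mem_twoSaturation hx hy)
      ?_
    · rintro x rfl
      exact ⟨0, by simp⟩
    rintro g - ⟨i, hi⟩ h - ⟨j, hj⟩
    rw [Subgroup.mem_bot] at hi hj
    obtain ⟨a, ha, hga⟩ := (Nat.dvd_prime_pow Nat.prime_two).1 (orderOf_dvd_of_pow_eq_one hi)
    obtain ⟨b, hb, hhb⟩ := (Nat.dvd_prime_pow Nat.prime_two).1 (orderOf_dvd_of_pow_eq_one hj)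
    have key : ∀ (x y : Ωˣ) (a b : ℕ), orderOf x = 2 ^ a → orderOf y = 2 ^ b → a ≤ b →
        ∃ n : ℕ, y ^ n = x := by
      intro x y a b hx hy hab
      have hprim : IsPrimitiveRoot (y : Ω) (2 ^ b) := by
        rw [← hy, ← orderOf_units]
        exact IsPrimitiveRoot.orderOf _
      have hx1 : (x : Ω) ^ 2 ^ b = 1 := by
        have h1 : x ^ 2 ^ b = 1 := orderOf_dvd_iff_pow_eq_one.1 (hx ▸ pow_dvd_pow 2 hab)
        rw [← Units.val_pow_eq_pow_val, h1, Units.val_one]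
      obtain ⟨n, -, hn⟩ := hprim.eq_pow_of_pow_eq_one hx1
      exact ⟨n, Units.ext (by simpa using hn)⟩
    rcases le_total a b with hab | hab
    · obtain ⟨n, hn⟩ := key g h a b hga hhb hab
      exact ⟨1, -n, Or.inl odd_one, by simp [← hn]⟩
    · obtain ⟨n, hn⟩ := key h g b a hhb hga hab
      exact ⟨-n, 1, Or.inr odd_one, by simp [← hn]⟩
  | insert s S hs ih =>
    obtain ⟨T, hT⟩ := ih
    have hmem : ∀ x, x ∈ Subgroup.closure ((insert s S : Finset Ωˣ) : Set Ωˣ) →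
        ∃ a : ℤ, ∃ y ∈ Subgroup.closure (S : Set Ωˣ), s ^ a * y = x := by
      intro x hx
      rw [Finset.coe_insert, Set.insert_eq, Subgroup.closure_union, Subgroup.mem_sup] at hx
      obtain ⟨u, hu, y, hy, rfl⟩ := hx
      obtain ⟨a, rfl⟩ := Subgroup.mem_closure_singleton.1 hu
      exact ⟨a, y, hy, rfl⟩
    refine exists_isSquareCover_of_relations U hT ?_ (fun x hx y hy => mul_mem_twoSaturation hx hy)
      ?_
    · rintro x ⟨j, hj⟩
      exact ⟨j, Subgroup.closure_mono (by simp) hj⟩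
    rintro g - ⟨i, hi⟩ h - ⟨j, hj⟩
    obtain ⟨a, u, hu, hgu⟩ := hmem _ (pow_mem_of_le hi (le_max_left i j))
    obtain ⟨b, v, hv, hhv⟩ := hmem _ (pow_mem_of_le hj (le_max_right i j))
    obtain ⟨c, d, hodd, hcd⟩ := exists_odd_relation a b
    refine ⟨c, d, hodd, max i j, ?_⟩
    have : (g ^ c * h ^ d) ^ 2 ^ max i j = u ^ c * v ^ d := by
      rw [mul_pow, ← zpow_natCast, ← zpow_natCast, zpow_comm, zpow_comm h, zpow_natCast,
        zpow_natCast, ← hgu, ← hhv, mul_zpow, mul_zpow, ← zpow_mul, ← zpow_mul,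
        mul_mul_mul_comm, ← zpow_add, hcd, zpow_zero, one_mul]
    rw [this]
    exact Subgroup.mul_mem _ (Subgroup.zpow_mem _ hu _) (Subgroup.zpow_mem _ hv _)

theorem exists_ringHom_extension_of_injective {A B M : Type*} [CommRing A] [IsDomain A]
    [CommRing B] [IsDomain B] [Algebra A B] [Algebra.IsIntegral A B] [FaithfulSMul A B]
    [Field M] [IsAlgClosed M] (φ : A →+* M) (hφ : Function.Injective φ) :
    ∃ ψ : B →+* M, ∀ a, ψ (algebraMap A B a) = φ a := by
  let := φ.toAlgebra
  have : FaithfulSMul A M := (faithfulSMul_iff_algebraMap_injective A M).2 hφ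
  let ψ : B →ₐ[A] M := IsAlgClosed.lift
  exact ⟨ψ, ψ.commutes⟩

theorem exists_ringHom_extension {A B M : Type*} [CommRing A] [CommRing B] [IsDomain B]
    [Algebra A B] [Algebra.IsIntegral A B] [FaithfulSMul A B] [Field M] [IsAlgClosed M]
    (φ : A →+* M) : ∃ ψ : B →+* M, ∀ a, ψ (algebraMap A B a) = φ a := by
  have := RingHom.ker_isPrime φ
  obtain ⟨Q, -, hQ, hQφ⟩ := Ideal.exists_ideal_over_prime_of_isIntegral (RingHom.ker φ)
    (⊥ : Ideal B) (by
      rw [← RingHom.ker_eq_comap_bot, (RingHom.injective_iff_ker_eq_bot _).1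
        (FaithfulSMul.algebraMap_injective A B)]
      exact bot_le)
  have : FaithfulSMul (A ⧸ Q.comap (algebraMap A B)) (B ⧸ Q) :=
    (faithfulSMul_iff_algebraMap_injective _ _).2 Ideal.algebraMap_quotient_injective
  obtain ⟨ψ, hψ⟩ := exists_ringHom_extension_of_injective (B := B ⧸ Q)
    (Ideal.Quotient.lift (Q.comap (algebraMap A B)) φ fun a ha => by rwa [hQφ] at ha)
    (Ideal.injective_lift_iff _ |>.2 hQφ.symm)
  exact ⟨ψ.comp (Ideal.Quotient.mk Q), fun a => hψ (Ideal.Quotient.mk _ a)⟩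

theorem not_transcendental_of_pow {L₀ L : Type*} [Field L₀] [Field L] [Algebra L₀ L] {x y : L}
    (hx : Transcendental L₀ x) [FiniteDimensional (IntermediateField.adjoin L₀ {x}) L] {n : ℕ}
    (hn : Module.finrank (IntermediateField.adjoin L₀ {x}) L < n) : y ^ n ≠ x := by
  intro hy
  have hnorm := (congrArg (Algebra.norm (IntermediateField.adjoin L₀ {x})) hy).trans
    (Algebra.norm_algebraMap (IntermediateField.AdjoinSimple.gen L₀ x))
  rw [map_pow] at hnorm
  generalize Algebra.norm (IntermediateField.adjoin L₀ {x}) y = v at hnorm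
  have : IsIntegrallyClosed (Algebra.adjoin L₀ {x}) :=
    IsIntegrallyClosed.of_equiv (Polynomial.algEquivOfTranscendental L₀ x hx).toRingEquiv
  have hpos : 0 < Module.finrank (IntermediateField.adjoin L₀ {x}) L := Module.finrank_pos
  obtain ⟨w, hw⟩ := IsIntegrallyClosed.exists_algebraMap_eq_of_isIntegral_pow
    (R := Algebra.adjoin L₀ {x}) (x := v) (n := n) (by omega) (by
      rw [hnorm]
      exact (isIntegral_algebraMap (R := Algebra.adjoin L₀ {x})
        (x := ⟨x, Algebra.self_mem_adjoin_singleton L₀ x⟩)).pow _)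
  obtain ⟨p, hp⟩ : ∃ p : Polynomial L₀, Polynomial.aeval x p = (v : L) := by
    obtain ⟨p, hp⟩ := (Algebra.adjoin_singleton_eq_range_aeval L₀ x).le w.2
    exact ⟨p, by rw [← hw]; exact hp⟩
  have hpX : p ^ n = Polynomial.X ^ Module.finrank (IntermediateField.adjoin L₀ {x}) L := by
    apply transcendental_iff_injective.1 hx
    have := congrArg (algebraMap (IntermediateField.adjoin L₀ {x}) L) hnorm
    simpa [hp] using this
  have hdeg := congrArg Polynomial.natDegree hpX
  rw [Polynomial.natDegree_pow, Polynomial.natDegree_X_pow] at hdeg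
  rcases Nat.eq_zero_or_pos p.natDegree with h0 | h0
  · rw [h0] at hdeg; omega
  · have := Nat.le_mul_of_pos_right n h0
    omega

theorem isAlgebraic_of_forall_exists_pow {k L : Type*} [Field k] [Field L] [Algebra k L]
    [Algebra.EssFiniteType k L] (x : L) (h : ∀ n : ℕ, ∃ y : L, y ^ 2 ^ n = x) :
    IsAlgebraic k x := by
  by_contra hx
  have hind : AlgebraicIndepOn k id ({x} : Set L) :=
    (algebraicIndependent_singleton_iff (x := fun i : ({x} : Set L) => (i : L)) ⟨x, rfl⟩).2 hx
  obtain ⟨s, hs, hb⟩ := exists_isTranscendenceBasis_superset hind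
  set L₀ := IntermediateField.adjoin k (s \ {x}) with hL₀
  have hins : insert x (s \ {x}) = s := by
    rw [Set.insert_sdiff_singleton, Set.insert_eq_of_mem (hs rfl)]
  have hxL : Transcendental L₀ x := by
    have h1 : AlgebraicIndepOn k id (insert x (s \ {x})) := by
      rw [hins]; exact hb.1
    have h2 := ((AlgebraicIndepOn.insert_iff (by simp)).1 h1).2
    rw [Set.image_id] at h2
    intro h3
    exact h2 ((IsFractionRing.isAlgebraic_iff (Algebra.adjoin k (s \ {x}))
      (IntermediateField.adjoin k (s \ {x})) L).2 h3)
  let M := IntermediateField.adjoin L₀ {x}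
  have : Algebra.IsAlgebraic M L := by
    have h1 := hb.isAlgebraic_field
    rw [Subtype.range_coe] at h1
    have h2 : M.restrictScalars k = IntermediateField.adjoin k s := by
      rw [IntermediateField.adjoin_adjoin_left, Set.union_singleton, hins]
    rw [← h2] at h1
    exact h1
  have : Algebra.EssFiniteType L₀ L := Algebra.EssFiniteType.of_comp k L₀ L
  have : Algebra.EssFiniteType M L := Algebra.EssFiniteType.of_comp L₀ M L
  have : FiniteDimensional M L :=
    Algebra.finite_of_essFiniteType_of_isAlgebraic
  obtain ⟨y, hy⟩ := h (Module.finrank M L)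
  exact not_transcendental_of_pow hxL Nat.lt_two_pow_self hy

theorem exists_eq_add_mul_of_mem_adjoin_sqrt {F L : Type*} [Field F] [Field L] [Algebra F L]
    {r x : L} {t : F} (hr : r ^ 2 = algebraMap F L t) (hx : x ∈ IntermediateField.adjoin F {r}) :
    ∃ a b : F, x = algebraMap F L a + algebraMap F L b * r := by
  have hmonic : (X ^ 2 - C t).Monic := monic_X_pow_sub_C t two_ne_zero
  have hroot : aeval r (X ^ 2 - C t) = 0 := by simp [hr]
  have hx' := (IntermediateField.adjoin_simple_toSubalgebra_of_isAlgebraic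
    (α := r) ⟨_, hmonic.ne_zero, hroot⟩).le hx
  obtain ⟨p, rfl⟩ := (Algebra.adjoin_singleton_eq_range_aeval F r).le hx'
  have hlt : (p %ₘ (X ^ 2 - C t)).natDegree ≤ 1 := by
    have := natDegree_modByMonic_lt p hmonic fun h => by
      simpa [natDegree_X_pow_sub_C] using congrArg natDegree h
    rw [natDegree_X_pow_sub_C] at this
    omega
  obtain ⟨b, a, hab⟩ := exists_eq_X_add_C_of_natDegree_le_one hlt
  refine ⟨a, b, ?_⟩
  change aeval r p = _
  rw [← aeval_modByMonic_eq_self_of_root hroot, hab]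
  simp [add_comm]

section TestPolynomial

variable {P R K Ω : Type*} [CommRing P] [CommRing R] [IsDomain R] [Field K] [Field Ω]
  [Algebra R K] [IsFractionRing R K] [Algebra K Ω] [Algebra R Ω] [IsScalarTower R K Ω]

theorem exists_isIntegral_add_mul_natDegree_minpoly_gt [CharZero K] (F : IntermediateField K Ω)
    [FiniteDimensional K F] {r : Ω} (hr : r ^ 2 ∈ F) (hrF : r ∉ F) :
    ∃ a ∈ F, ∃ b ∈ F, IsIntegral R a ∧ IsIntegral R b ∧
      Module.finrank K F < (minpoly K (a + b * r)).natDegree := by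
  have hint : IsIntegral F r := IsIntegral.of_pow two_pos
    (by simpa using isIntegral_algebraMap (R := F) (A := Ω) (x := ⟨r ^ 2, hr⟩))
  have : FiniteDimensional F (IntermediateField.adjoin F {r}) :=
    IntermediateField.adjoin.finiteDimensional hint
  let E := (IntermediateField.adjoin F {r}).restrictScalars K
  have : FiniteDimensional K E :=
    FiniteDimensional.trans K F (IntermediateField.adjoin F {r})
  have hFE : F ≤ E := fun x hx => (IntermediateField.adjoin F {r}).algebraMap_mem ⟨x, hx⟩
  have hrE : r ∈ E := IntermediateField.mem_adjoin_simple_self F r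
  have hlt : Module.finrank K F < Module.finrank K E := by
    by_contra! hle
    exact hrF (IntermediateField.eq_of_le_of_finrank_le hFE hle ▸ hrE)
  obtain ⟨α, hα⟩ := Field.exists_primitive_element K E
  obtain ⟨a, b, hab⟩ := exists_eq_add_mul_of_mem_adjoin_sqrt (F := F) (r := r) (t := ⟨r ^ 2, hr⟩)
    rfl (show (α : Ω) ∈ IntermediateField.adjoin F {r} from α.2)
  classical
  obtain ⟨s, hs0, hs⟩ := exists_integral_multiples R K (L := F) {a, b}
  have hs0' : algebraMap R K s ≠ 0 := by
    simpa using hs0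
  have hβ : IntermediateField.adjoin K {algebraMap R K s • α} = ⊤ := by
    rw [eq_top_iff, ← hα, IntermediateField.adjoin_simple_le_iff]
    have := IntermediateField.smul_mem _ (IntermediateField.mem_adjoin_simple_self K
      (algebraMap R K s • α)) (x := (algebraMap R K s)⁻¹)
    rwa [smul_smul, inv_mul_cancel₀ hs0', one_smul] at this
  rw [Field.primitive_element_iff_minpoly_natDegree_eq] at hβ
  have : IsScalarTower R F Ω := IsScalarTower.of_algebraMap_eq fun _ => rfl
  refine ⟨_, (s • a).2, _, (s • b).2, ?_, ?_, ?_⟩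
  · exact (hs a (by simp)).map (IsScalarTower.toAlgHom R F Ω)
  · exact (hs b (by simp)).map (IsScalarTower.toAlgHom R F Ω)
  · refine hlt.trans_eq (hβ.symm.trans ?_)
    rw [← minpoly.algebraMap_eq (algebraMap E Ω).injective]
    congr 2
    change algebraMap R K s • (α : Ω) = s • (a : Ω) + s • (b : Ω) * r
    rw [hab, algebraMap_smul, smul_add, smul_mul_assoc]
    rfl

variable [IsDomain P] [UniqueFactorizationMonoid P] [Algebra P K] [Algebra.IsAlgebraic P K]
  [FaithfulSMul P K] [Algebra P Ω] [IsScalarTower P K Ω]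

theorem exists_irreducible_aeval_eq_zero_s12 {θ : Ω} (hθ : IsAlgebraic K θ) :
    ∃ f : P[X], Irreducible f ∧ aeval θ f = 0 ∧ (minpoly K θ).natDegree ≤ f.natDegree := by
  obtain ⟨p, hp0, hp⟩ := hθ.restrictScalars P
  obtain ⟨f, hf, hprime⟩ := (RingHom.ker_isPrime (aeval θ : P[X] →ₐ[P] Ω)).exists_mem_prime_of_ne_bot
    fun h => hp0 (by simpa [h] using (RingHom.mem_ker (f := (aeval θ : P[X] →ₐ[P] Ω))).2 hp)
  have hf' : aeval θ f = 0 := hf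
  refine ⟨f, hprime.irreducible, hf', ?_⟩
  have h0 : f.map (algebraMap P K) ≠ 0 :=
    (Polynomial.map_ne_zero_iff (FaithfulSMul.algebraMap_injective P K)).2 hprime.ne_zero
  exact (natDegree_le_of_dvd (minpoly.dvd K θ (by rwa [aeval_map_algebraMap])) h0).trans
    natDegree_map_le

end TestPolynomial

/-- A root of a monic polynomial over `R` of degree less than that of an irreducible polynomial
cannot specialize to a root of that irreducible polynomial. -/
theorem natDegree_le_of_irreducible_of_aeval_eq_zero {K' M : Type*} [Field K'] [Field M]
    [Algebra K' M] {f q : K'[X]} (hf : Irreducible f) (hq : q ≠ 0) {x : M} (hfx : aeval x f = 0)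
    (hqx : aeval x q = 0) : f.natDegree ≤ q.natDegree := by
  refine natDegree_le_of_dvd ?_ hq
  have h1 := minpoly.dvd K' x hqx
  rw [← minpoly.eq_of_irreducible hf hfx] at h1
  exact (dvd_mul_right _ _).trans h1

theorem isIntegral_of_mem_twoSaturation {R Ω : Type*} [CommRing R] [Field Ω] [Algebra R Ω]
    {A : Subgroup Ωˣ} (hA : ∀ x ∈ A, IsIntegral R (x : Ω)) {x : Ωˣ}
    (hx : x ∈ twoSaturation A) : IsIntegral R (x : Ω) := by
  obtain ⟨j, hj⟩ := hx
  exact IsIntegral.of_pow (pow_pos two_pos j) (by simpa using hA _ hj)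

section Specialization

variable {P R K Ω K' M : Type*} [CommRing P] [CommRing R] [IsDomain R] [IsIntegrallyClosed R]
  [Field K] [Field Ω] [Algebra R K] [IsFractionRing R K] [Algebra K Ω] [Algebra R Ω]
  [IsScalarTower R K Ω] [Field K'] [Field M] [Algebra K' M]
  (F : IntermediateField K Ω) [FiniteDimensional K F]
  {φ : R →+* K'} {ψ : integralClosure R Ω →+* M}

theorem specialization_ne_of_irreducible [Algebra P R] [Algebra P Ω] [IsScalarTower P R Ω]
    (hψ : ∀ r : R, ψ (algebraMap R (integralClosure R Ω) r) = algebraMap K' M (φ r)) {f : P[X]}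
    (hf : Irreducible (f.map (φ.comp (algebraMap P R))))
    (hdeg : Module.finrank K F < (f.map (φ.comp (algebraMap P R))).natDegree)
    {θ θ' : integralClosure R Ω} (hθ : aeval (θ : Ω) f = 0) (hθ' : (θ' : Ω) ∈ F) :
    ψ θ ≠ ψ θ' := by
  intro heq
  have hcomp : ψ.comp (algebraMap R (integralClosure R Ω)) = (algebraMap K' M).comp φ :=
    RingHom.ext hψ
  have hmonic : (minpoly R (θ' : Ω)).Monic := minpoly.monic θ'.2
  have hle : (minpoly R (θ' : Ω)).natDegree ≤ Module.finrank K F := by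
    have h1 := minpoly.isIntegrallyClosed_eq_field_fractions' K (s := (θ' : Ω)) θ'.2
    have h2 : minpoly K (θ' : Ω) = minpoly K (⟨θ', hθ'⟩ : F) :=
      minpoly.algebraMap_eq (algebraMap F Ω).injective (⟨θ', hθ'⟩ : F)
    rw [← hmonic.natDegree_map (algebraMap R K), ← h1, h2]
    exact minpoly.natDegree_le _
  have key : ∀ (g : R[X]) (c : integralClosure R Ω), aeval (c : Ω) g = 0 →
      aeval (ψ c) (g.map φ) = 0 := by
    intro g c hc
    have hc' : aeval c g = 0 := by
      apply Subtype.coe_injective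
      simpa using hc
    rw [aeval_def, eval₂_map, ← hcomp, ← hom_eval₂, ← aeval_def, hc', map_zero]
  have hfθ : aeval (ψ θ) (f.map (φ.comp (algebraMap P R))) = 0 := by
    rw [← Polynomial.map_map]
    exact key _ _ (by rwa [aeval_map_algebraMap])
  have hq := key _ _ (minpoly.aeval R (θ' : Ω))
  rw [← heq] at hq
  have := natDegree_le_of_irreducible_of_aeval_eq_zero hf (hmonic.map φ).ne_zero hfθ hq
  rw [hmonic.natDegree_map] at this
  omega

variable {A : Subgroup Ωˣ}

theorem mem_units_of_mem {F : IntermediateField K Ω} {x : Ωˣ} (hx : (x : Ω) ∈ F) :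
    x ∈ F.toSubmonoid.units :=
  (Submonoid.mem_units_iff _ _).2 ⟨hx, by simpa using F.inv_mem hx⟩

variable (R) in
/-- `f` is the polynomial of an integral generator `a + b √t` whose degree over `K` exceeds that
of `F`. -/
def IsSqrtTestPoly [Algebra P Ω] (t : Ω) (f : P[X]) : Prop :=
  Irreducible f ∧ Module.finrank K F < f.natDegree ∧
    ∃ r a b : Ω, r ^ 2 = t ∧ a ∈ F ∧ b ∈ F ∧ IsIntegral R a ∧ IsIntegral R b ∧
      aeval (a + b * r) f = 0

theorem exists_sqrt_specialization_eq_one [Algebra P R] [Algebra P Ω] [IsScalarTower P R Ω]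
    (hψ : ∀ r : R, ψ (algebraMap R (integralClosure R Ω) r) = algebraMap K' M (φ r))
    (hA : ∀ x ∈ A, IsIntegral R (x : Ω)) {T : Finset Ωˣ}
    (hT : IsSquareCover F.toSubmonoid.units (twoSaturation A) T)
    (hf : ∀ t ∈ T, (∀ s ∈ F, s ^ 2 ≠ (t : Ω)) → ∃ f : P[X], IsSqrtTestPoly R F (t : Ω) f ∧
      Irreducible (f.map (φ.comp (algebraMap P R))) ∧
      (f.map (φ.comp (algebraMap P R))).natDegree = f.natDegree)
    {x : Ωˣ} (hxF : (x : Ω) ∈ F) (hxA : x ∈ twoSaturation A)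
    (hx : ψ ⟨x, isIntegral_of_mem_twoSaturation hA hxA⟩ = 1) :
    ∃ y : Ωˣ, y ^ 2 = x ∧ (y : Ω) ∈ F ∧ ∃ hy : y ∈ twoSaturation A,
      ψ ⟨y, isIntegral_of_mem_twoSaturation hA hy⟩ = 1 := by
  obtain ⟨t, ht, y, hy, rfl⟩ := hT.2 x (mem_units_of_mem hxF) hxA
  have hyF : (y : Ω) ∈ F := Submonoid.val_mem_of_mem_units _ hy
  by_cases hsq : ∃ s ∈ F, s ^ 2 = (t : Ω)
  · obtain ⟨s, hsF, hs⟩ := hsq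
    obtain ⟨u, rfl⟩ : IsUnit s := (pow_ne_zero_iff two_ne_zero).1 (hs ▸ t.ne_zero) |>.isUnit
    have hu : (u * y) ^ 2 = t * y ^ 2 := by
      rw [mul_pow]
      congr 1
      exact Units.ext (by simpa using hs)
    have hu' : (-(u * y)) ^ 2 = t * y ^ 2 := by rw [neg_sq, hu]
    have hmem : u * y ∈ twoSaturation A := mem_twoSaturation_of_sq (hu ▸ hxA)
    have hmem' : -(u * y) ∈ twoSaturation A := mem_twoSaturation_of_sq (hu' ▸ hxA)
    have huF : ((u * y : Ωˣ) : Ω) ∈ F := F.mul_mem hsF hyF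
    have hone : ψ ⟨_, isIntegral_of_mem_twoSaturation hA hmem⟩ ^ 2 = 1 := by
      rw [← map_pow, ← hx]
      congr 1
      exact Subtype.ext (by simpa using congrArg Units.val hu)
    rcases sq_eq_sq_iff_eq_or_eq_neg.1 (hone.trans (one_pow 2).symm) with h1 | h1
    · exact ⟨_, hu, huF, hmem, h1⟩
    · refine ⟨_, hu', by simpa using huF, hmem', ?_⟩
      rw [← neg_eq_iff_eq_neg, ← map_neg] at h1
      rw [← h1]
      congr 1
  · push Not at hsq
    obtain ⟨f, ⟨-, hlt, r, a, b, hrt, haF, hbF, haR, hbR, hroot⟩, hirr, hdeg⟩ := hf t ht hsq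
    have htA := (hT.1 t ht).2
    have hyA : y⁻¹ ∈ twoSaturation A := by
      refine mem_twoSaturation_of_sq ?_
      have := mul_mem_twoSaturation htA (inv_mem_twoSaturation hxA)
      rwa [mul_inv, mul_inv_cancel_left, ← inv_pow] at this
    have hrR : IsIntegral R r := IsIntegral.of_pow two_pos
      (hrt ▸ isIntegral_of_mem_twoSaturation hA htA)
    let a' : integralClosure R Ω := ⟨a, haR⟩
    let b' : integralClosure R Ω := ⟨b, hbR⟩
    let r' : integralClosure R Ω := ⟨r, hrR⟩
    let y' : integralClosure R Ω := ⟨_, isIntegral_of_mem_twoSaturation hA hyA⟩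
    have hy'F : (y' : Ω) ∈ F := by
      change ((y⁻¹ : Ωˣ) : Ω) ∈ F
      rw [Units.val_inv_eq_inv_val]
      exact F.inv_mem hyF
    have hsq' : ψ r' ^ 2 = ψ y' ^ 2 := by
      have h1 : r' ^ 2 = ⟨_, isIntegral_of_mem_twoSaturation hA hxA⟩ * y' ^ 2 := by
        apply Subtype.ext
        change r ^ 2 = ((t * y ^ 2 : Ωˣ) : Ω) * ((y⁻¹ : Ωˣ) : Ω) ^ 2
        rw [hrt, ← Units.val_pow_eq_pow_val, ← Units.val_mul]
        simp
      rw [← map_pow, h1, map_mul, hx, one_mul, map_pow]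
    have hne : ∀ c : integralClosure R Ω, (c : Ω) ∈ F → ψ (a' + b' * r') ≠ ψ c := fun c hc =>
      specialization_ne_of_irreducible F hψ hirr (hdeg ▸ hlt) hroot hc
    rcases sq_eq_sq_iff_eq_or_eq_neg.1 hsq' with h1 | h1
    · exact absurd (by simp [h1]) (hne (a' + b' * y') (F.add_mem haF (F.mul_mem hbF hy'F)))
    · exact absurd (by simp [h1]) (hne (a' + b' * -y')
        (F.add_mem haF (F.mul_mem hbF (F.neg_mem hy'F))))

theorem exists_pow_specialization_eq_one [Algebra P R] [Algebra P Ω] [IsScalarTower P R Ω]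
    (hψ : ∀ r : R, ψ (algebraMap R (integralClosure R Ω) r) = algebraMap K' M (φ r))
    (hA : ∀ x ∈ A, IsIntegral R (x : Ω)) {T : Finset Ωˣ}
    (hT : IsSquareCover F.toSubmonoid.units (twoSaturation A) T)
    (hf : ∀ t ∈ T, (∀ s ∈ F, s ^ 2 ≠ (t : Ω)) → ∃ f : P[X], IsSqrtTestPoly R F (t : Ω) f ∧
      Irreducible (f.map (φ.comp (algebraMap P R))) ∧
      (f.map (φ.comp (algebraMap P R))).natDegree = f.natDegree)
    {x : Ωˣ} (hxF : (x : Ω) ∈ F) (hxA : x ∈ A)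
    (hx : ψ ⟨x, hA x hxA⟩ = 1) (n : ℕ) :
    ∃ y : F, y ^ 2 ^ n = ⟨x, hxF⟩ := by
  suffices ∃ y : Ωˣ, y ^ 2 ^ n = x ∧ (y : Ω) ∈ F ∧ ∃ hy : y ∈ twoSaturation A,
      ψ ⟨y, isIntegral_of_mem_twoSaturation hA hy⟩ = 1 by
    obtain ⟨y, rfl, hyF, -⟩ := this
    exact ⟨⟨y, hyF⟩, Subtype.ext (by simp)⟩
  induction n with
  | zero => exact ⟨x, by simp, hxF, ⟨0, by simpa using hxA⟩, hx⟩
  | succ n ih =>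
    obtain ⟨y, rfl, hyF, hyA, hy⟩ := ih
    obtain ⟨w, rfl, hw⟩ := exists_sqrt_specialization_eq_one F hψ hA hT hf hyF hyA hy
    exact ⟨w, by rw [← pow_mul, pow_succ'], hw⟩

end Specialization

theorem exists_isSqrtTestPoly {P R K Ω : Type*} [CommRing P] [CommRing R] [IsDomain R] [Field K]
    [Field Ω] [IsAlgClosed Ω] [Algebra R K] [IsFractionRing R K] [Algebra K Ω] [Algebra R Ω]
    [IsScalarTower R K Ω] [CharZero K] [IsDomain P] [UniqueFactorizationMonoid P] [Algebra P K]
    [Algebra.IsAlgebraic P K] [FaithfulSMul P K] [Algebra P Ω] [IsScalarTower P K Ω]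
    (F : IntermediateField K Ω) [FiniteDimensional K F] {t : Ω} (htF : t ∈ F)
    (ht : ∀ s ∈ F, s ^ 2 ≠ t) : ∃ f : P[X], IsSqrtTestPoly R F t f := by
  obtain ⟨r, rfl⟩ := IsAlgClosed.exists_pow_nat_eq t two_pos
  have hrF : r ∉ F := fun h => ht r h rfl
  obtain ⟨a, haF, b, hbF, haR, hbR, hlt⟩ :=
    exists_isIntegral_add_mul_natDegree_minpoly_gt (R := R) F htF hrF
  have hint : IsIntegral K (a + b * r) :=
    minpoly.ne_zero_iff.1 fun h => by rw [h] at hlt; simp at hlt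
  obtain ⟨f, hirr, hroot, hle⟩ := exists_irreducible_aeval_eq_zero_s12 (P := P) hint.isAlgebraic
  exact ⟨f, hirr, hlt.trans_le hle, r, a, b, rfl, haF, hbF, haR, hbR, hroot⟩

theorem AlgHom.eq_zero_of_isAlgebraic {k D M : Type*} [Field k] [CommRing D] [IsDomain D]
    [Algebra k D] [CommRing M] [Nontrivial M] [Algebra k M] (φ : D →ₐ[k] M) {x : D}
    (hx : IsAlgebraic k x) (h0 : φ x = 0) : x = 0 := by
  have h1 := congrArg φ (minpoly.aeval k x)
  rw [← aeval_algHom_apply, h0, map_zero, ← coeff_zero_eq_aeval_zero', map_eq_zero] at h1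
  exact (minpoly.coeff_zero_eq_zero hx.isIntegral).1 h1

section Concrete

variable {Ω : Type*} [Field Ω] (k : Type*) [Field k] [Algebra k Ω] {m : ℕ} (z : Fin m → Ω)
  (δ : MvPolynomial (Fin m) k) (η : Ω)

/-- The algebra `k[z, 1/δ(z)]`. -/
noncomputable abbrev baseAlg : Subalgebra k Ω :=
  Algebra.adjoin k (Set.range z ∪ {(MvPolynomial.aeval z δ)⁻¹})

/-- The field `k(z)`. -/
noncomputable abbrev baseField : IntermediateField k Ω :=
  IntermediateField.adjoin k (Set.range z ∪ {(MvPolynomial.aeval z δ)⁻¹})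

theorem aeval_mem_baseAlg (p : MvPolynomial (Fin m) k) :
    MvPolynomial.aeval z p ∈ baseAlg k z δ :=
  Algebra.adjoin_mono Set.subset_union_left
    (Algebra.adjoin_range_eq_range_aeval k z ▸ ⟨p, rfl⟩)

/-- Evaluation at `z`, as a homomorphism to `k[z, 1/δ(z)]`. -/
noncomputable def toBaseAlg : MvPolynomial (Fin m) k →ₐ[k] baseAlg k z δ :=
  (MvPolynomial.aeval z).codRestrict _ (aeval_mem_baseAlg k z δ)

variable {k z δ}

theorem exists_mul_pow_eq_aeval (hδ : MvPolynomial.aeval z δ ≠ 0) {x : Ω}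
    (hx : x ∈ baseAlg k z δ) :
    ∃ (n : ℕ) (p : MvPolynomial (Fin m) k),
      x * MvPolynomial.aeval z δ ^ n = MvPolynomial.aeval z p := by
  induction hx using Algebra.adjoin_induction with
  | mem x hx =>
    rcases hx with ⟨i, rfl⟩ | rfl
    · exact ⟨0, MvPolynomial.X i, by simp⟩
    · exact ⟨1, 1, by simp [hδ]⟩
  | algebraMap r => exact ⟨0, MvPolynomial.C r, by simp⟩
  | add x y _ _ hx hy =>
    obtain ⟨n, p, hp⟩ := hx
    obtain ⟨l, q, hq⟩ := hy
    exact ⟨n + l, p * δ ^ l + q * δ ^ n, by simp only [map_add, map_mul, map_pow, ← hp, ← hq]; ring⟩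
  | mul x y _ _ hx hy =>
    obtain ⟨n, p, hp⟩ := hx
    obtain ⟨l, q, hq⟩ := hy
    exact ⟨n + l, p * q, by simp only [map_mul, ← hp, ← hq]; ring⟩

theorem isLocalization_baseAlg (hz : AlgebraicIndependent k z) (hδ : δ ≠ 0) :
    letI := (toBaseAlg k z δ).toAlgebra
    IsLocalization.Away δ (baseAlg k z δ) := by
  let := (toBaseAlg k z δ).toAlgebra
  have hδ' : MvPolynomial.aeval z δ ≠ 0 := (map_ne_zero_iff _ hz).2 hδ
  refine ⟨?_, ?_, ?_⟩
  · have hunit : IsUnit (algebraMap _ (baseAlg k z δ) δ) := isUnit_iff_exists_inv.2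
      ⟨⟨_, Algebra.subset_adjoin (Or.inr rfl)⟩, Subtype.ext (mul_inv_cancel₀ hδ')⟩
    rintro ⟨_, n, rfl⟩
    rw [map_pow]
    exact hunit.pow n
  · rintro ⟨x, hx⟩
    obtain ⟨n, p, hp⟩ := exists_mul_pow_eq_aeval hδ' hx
    exact ⟨⟨p, δ ^ n, n, rfl⟩, Subtype.ext (by rw [map_pow]; exact hp)⟩
  · intro x y hxy
    exact ⟨1, by rw [hz (congrArg Subtype.val hxy)]⟩

theorem baseAlg_le_Dalg : baseAlg k z δ ≤ Dalg k z δ η :=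
  Algebra.adjoin_mono (Set.union_subset_union_right _ (by simp))

theorem isIntegral_of_mem_Dalg (hη : IsIntegral (baseAlg k z δ) η) {x : Ω}
    (hx : x ∈ Dalg k z δ η) : IsIntegral (baseAlg k z δ) x := by
  have hle : Dalg k z δ η ≤ (integralClosure (baseAlg k z δ) Ω).restrictScalars k := by
    refine Algebra.adjoin_le ?_
    rintro x (hx | rfl | rfl)
    · exact isIntegral_algebraMap 
        (x := (⟨x, Algebra.subset_adjoin (Or.inl hx)⟩ : baseAlg k z δ))
    · exact isIntegral_algebraMap
        (x := (⟨_, Algebra.subset_adjoin (Or.inr rfl)⟩ : baseAlg k z δ))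
    · exact hη
  exact hle hx

theorem exists_ringHom_extension_Dalg (hη : IsIntegral (baseAlg k z δ) η) {M : Type*} [Field M]
    [IsAlgClosed M] (φ : Dalg k z δ η →+* M) :
    ∃ ψ : integralClosure (baseAlg k z δ) Ω →+* M, ∀ (x : Ω) (hx : x ∈ Dalg k z δ η),
      ψ ⟨x, isIntegral_of_mem_Dalg η hη hx⟩ = φ ⟨x, hx⟩ := by
  have hle : Dalg k z δ η ≤ (integralClosure (baseAlg k z δ) Ω).restrictScalars k :=
    fun _ => isIntegral_of_mem_Dalg η hη
  let ι : Dalg k z δ η →+* integralClosure (baseAlg k z δ) Ω := (Subalgebra.inclusion hle).toRingHom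
  let := ι.toAlgebra
  have : Algebra.IsIntegral (Dalg k z δ η) (integralClosure (baseAlg k z δ) Ω) := by
    refine algebraMap_isIntegral_iff.1 (RingHom.IsIntegral.tower_top
      (Subalgebra.inclusion (baseAlg_le_Dalg (k := k) (z := z) (δ := δ) η)).toRingHom ι ?_)
    exact algebraMap_isIntegral_iff.2 (inferInstanceAs
      (Algebra.IsIntegral (baseAlg k z δ) (integralClosure (baseAlg k z δ) Ω)))
  have : FaithfulSMul (Dalg k z δ η) (integralClosure (baseAlg k z δ) Ω) :=
    (faithfulSMul_iff_algebraMap_injective _ _).2 (Subalgebra.inclusion_injective hle)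
  obtain ⟨ψ, hψ⟩ := exists_ringHom_extension (B := integralClosure (baseAlg k z δ) Ω) φ
  exact ⟨ψ, fun x hx => hψ ⟨x, hx⟩⟩

end Concrete

section Main

variable {Ω : Type*} [Field Ω] [IsAlgClosed Ω] [CharZero Ω] {k : Type*} [Field k] [Algebra k Ω]
  {kbar : Type*} [Field kbar] [Algebra k kbar]
  {m : ℕ} {z : Fin m → Ω} {δ : MvPolynomial (Fin m) k} {η : Ω}

theorem specialization_aeval (φ : Dalg k z δ η →ₐ[k] kbar) (p : MvPolynomial (Fin m) k) :
    φ ⟨MvPolynomial.aeval z p, aeval_mem k z δ η p⟩ =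
      MvPolynomial.aeval (fun i => φ ⟨z i, z_mem k z δ η i⟩) p := by
  have h : (⟨MvPolynomial.aeval z p, aeval_mem k z δ η p⟩ : Dalg k z δ η) =
      MvPolynomial.aeval (fun i => (⟨z i, z_mem k z δ η i⟩ : Dalg k z δ η)) p :=
    Subtype.ext (MvPolynomial.comp_aeval_apply (fun i => (⟨z i, z_mem k z δ η i⟩ : Dalg k z δ η))
      (Dalg k z δ η).val p).symm
  rw [h, MvPolynomial.comp_aeval_apply]

theorem specialization_mem_adjoin (φ : Dalg k z δ η →ₐ[k] kbar) {x : Ω} (hx : x ∈ baseAlg k z δ) :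
    φ ⟨x, baseAlg_le_Dalg η hx⟩ ∈
      IntermediateField.adjoin k (Set.range fun i => φ ⟨z i, z_mem k z δ η i⟩) := by
  set K' := IntermediateField.adjoin k (Set.range fun i => φ ⟨z i, z_mem k z δ η i⟩)
  have hle : baseAlg k z δ ≤ (K'.toSubalgebra.comap φ).map (Dalg k z δ η).val := by
    refine Algebra.adjoin_le ?_
    rintro _ (⟨i, rfl⟩ | rfl)
    · exact ⟨⟨z i, z_mem k z δ η i⟩, IntermediateField.subset_adjoin k _ ⟨i, rfl⟩, rfl⟩
    · have hinv : (MvPolynomial.aeval z δ)⁻¹ ∈ Dalg k z δ η :=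
        Algebra.subset_adjoin (Or.inr (Or.inl rfl))
      refine ⟨⟨_, hinv⟩, ?_, rfl⟩
      change φ _ ∈ K'
      by_cases h0 : MvPolynomial.aeval z δ = 0
      · have : (⟨_, hinv⟩ : Dalg k z δ η) = 0 := Subtype.ext (by simp [h0])
        rw [this, map_zero]
        exact K'.zero_mem
      have hmul : φ ⟨_, hinv⟩ * φ ⟨_, aeval_mem k z δ η δ⟩ = 1 := by
        rw [← map_mul, ← map_one φ]
        congr 1
        exact Subtype.ext (inv_mul_cancel₀ h0)
      rw [eq_inv_of_mul_eq_one_left hmul, specialization_aeval]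
      refine K'.inv_mem ?_
      have : MvPolynomial.aeval (fun i => φ ⟨z i, z_mem k z δ η i⟩) δ ∈
          Algebra.adjoin k (Set.range fun i => φ ⟨z i, z_mem k z δ η i⟩) := by
        rw [Algebra.adjoin_range_eq_range_aeval]
        exact ⟨δ, rfl⟩
      exact IntermediateField.algebra_adjoin_le_adjoin k _ this
  obtain ⟨y, hy, rfl⟩ := hle hx
  exact hy

/-- The restriction of a specialization to `k[z, 1/δ(z)]`, with values in `k(φ(z))`. -/
noncomputable def baseSpecialization (φ : Dalg k z δ η →ₐ[k] kbar) :
    baseAlg k z δ →ₐ[k]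
      IntermediateField.adjoin k (Set.range fun i => φ ⟨z i, z_mem k z δ η i⟩) :=
  (φ.comp (Subalgebra.inclusion (baseAlg_le_Dalg η))).codRestrict
    (IntermediateField.adjoin k _).toSubalgebra fun x => specialization_mem_adjoin φ x.2

theorem baseSpecialization_comp_toBaseAlg (φ : Dalg k z δ η →ₐ[k] kbar) :
    (baseSpecialization φ).comp (toBaseAlg k z δ) =
      MvPolynomial.aeval fun i => ⟨φ ⟨z i, z_mem k z δ η i⟩,
        IntermediateField.subset_adjoin k _ ⟨i, rfl⟩⟩ := by
  refine MvPolynomial.algHom_ext fun i => Subtype.ext ?_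
  rw [MvPolynomial.aeval_X]
  exact congrArg φ (Subtype.ext (MvPolynomial.aeval_X z i))

theorem specPoly_eq_map (φ : Dalg k z δ η →ₐ[k] kbar)
    (f : Polynomial (MvPolynomial (Fin m) k)) :
    specPoly k kbar z δ η φ f =
      f.map ((baseSpecialization φ).toRingHom.comp (toBaseAlg k z δ).toRingHom) :=
  congrArg (fun h => f.map (AlgHom.toRingHom h)) (baseSpecialization_comp_toBaseAlg φ).symm

end Main

/-- Proposition 2.19 of the paper. Assume hypothesis (H) and that `k` is
finitely generated over `ℚ` as a field. For every finitely generated subgroup `Γ` of the group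
of units of `D` there exist a finite set `𝐟` of irreducible polynomials in `k[z,y] ∖ k[z]` and
a nonzero `g ∈ k[z]` with `ℋ_D(d,𝐟,g) ⊆ ℬ(D,Γ)` for every `d > 0`. -/
theorem Hset_subset_specB_of_unitSubgroup
    {Ω : Type*} [Field Ω] [IsAlgClosed Ω] [CharZero Ω]
    (k : Type*) [Field k] [Algebra k Ω] [CharZero k]
    (kbar : Type*) [Field kbar] [Algebra k kbar] [IsAlgClosure k kbar]
    -- `k` is finitely generated over `ℚ` as a field
    (hkfin : ∃ s : Finset k, IntermediateField.adjoin ℚ (s : Set k) = ⊤)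
    {m : ℕ} (z : Fin m → Ω) (δ : MvPolynomial (Fin m) k) (η : Ω)
    -- hypothesis (H)
    (hm : 0 < m) (hz : AlgebraicIndependent k z) (hδ : δ ≠ 0)
    (hη : IsIntegral ↥(Algebra.adjoin k (Set.range z ∪ {(MvPolynomial.aeval z δ)⁻¹})) η)
    -- `Γ` is a finitely generated subgroup of the group of units of `D`
    (Γ : Subgroup Ωˣ) (hΓfg : Γ.FG)
    (hΓD : ∀ u : Ωˣ, u ∈ Γ → (u : Ω) ∈ Dalg k z δ η) :
    ∃ (fs : Finset (Polynomial (MvPolynomial (Fin m) k))) (g : MvPolynomial (Fin m) k),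
      (∀ f ∈ fs, Irreducible f ∧ 0 < f.natDegree) ∧ g ≠ 0 ∧
      ∀ d : ℕ, 0 < d →
        Hset k kbar z δ η d fs g
          ⊆ specB k kbar (Dalg k z δ η) (Units.val '' (Γ : Set Ωˣ)) := by
  classical
  let : Algebra (MvPolynomial (Fin m) k) (baseAlg k z δ) := (toBaseAlg k z δ).toAlgebra
  let : Algebra (MvPolynomial (Fin m) k) (baseField k z δ) :=
    ((algebraMap (baseAlg k z δ) (baseField k z δ)).comp
      (algebraMap (MvPolynomial (Fin m) k) (baseAlg k z δ))).toAlgebra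
  let : Algebra (MvPolynomial (Fin m) k) Ω := (MvPolynomial.aeval z).toAlgebra
  have : IsScalarTower (MvPolynomial (Fin m) k) (baseAlg k z δ) (baseField k z δ) :=
    IsScalarTower.of_algebraMap_eq fun _ => rfl
  have : IsScalarTower (MvPolynomial (Fin m) k) (baseAlg k z δ) Ω :=
    IsScalarTower.of_algebraMap_eq fun _ => rfl
  have : IsScalarTower (MvPolynomial (Fin m) k) (baseField k z δ) Ω :=
    IsScalarTower.of_algebraMap_eq fun _ => rfl
  have hloc : IsLocalization.Away δ (baseAlg k z δ) := isLocalization_baseAlg hz hδ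
  have hδle := powers_le_nonZeroDivisors_of_noZeroDivisors hδ
  have : IsIntegrallyClosed (baseAlg k z δ) := isIntegrallyClosed_of_isLocalization _ _ hδle
  have : Algebra.IsAlgebraic (MvPolynomial (Fin m) k) (baseAlg k z δ) :=
    IsLocalization.isAlgebraic _ (Submonoid.powers δ)
  have : Algebra.IsAlgebraic (MvPolynomial (Fin m) k) (baseField k z δ) :=
    Algebra.IsAlgebraic.trans _ (baseAlg k z δ) _
  have : FaithfulSMul (MvPolynomial (Fin m) k) (baseField k z δ) :=
    (faithfulSMul_iff_algebraMap_injective _ _).2 fun x y hxy =>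
      hz (congrArg (algebraMap (baseField k z δ) Ω) hxy)
  have : CharZero (baseField k z δ) := charZero_of_injective_algebraMap
    (algebraMap k (baseField k z δ)).injective
  let F := IntermediateField.adjoin (baseField k z δ) {η}
  have : FiniteDimensional (baseField k z δ) F :=
    IntermediateField.adjoin.finiteDimensional (hη.tower_top (A := baseField k z δ))
  have : Algebra.EssFiniteType k (baseField k z δ) :=
    IntermediateField.essFiniteType_iff.2
      (IntermediateField.fg_adjoin_of_finite ((Set.finite_range z).union (Set.finite_singleton _)))
  have : Algebra.EssFiniteType k F := Algebra.EssFiniteType.comp k (baseField k z δ) F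
  have hDF : Dalg k z δ η ≤ (F.restrictScalars k).toSubalgebra := by
    refine Algebra.adjoin_le ?_
    have hS : Set.range z ∪ {(MvPolynomial.aeval z δ)⁻¹} ⊆ (F : Set Ω) := fun x hx =>
      F.algebraMap_mem ⟨x, IntermediateField.subset_adjoin k _ hx⟩
    rintro x (hx | rfl | rfl)
    · exact hS (Or.inl hx)
    · exact hS (Or.inr rfl)
    · exact IntermediateField.mem_adjoin_simple_self _ x
  obtain ⟨S, rfl⟩ := hΓfg
  obtain ⟨T, hT⟩ := exists_isSquareCover_twoSaturation F.toSubmonoid.units S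
  have htest : ∀ t : Ωˣ, (t : Ω) ∈ F → (∀ s ∈ F, s ^ 2 ≠ (t : Ω)) →
      ∃ f : Polynomial (MvPolynomial (Fin m) k), IsSqrtTestPoly (baseAlg k z δ) F (t : Ω) f :=
    fun t => exists_isSqrtTestPoly F
  choose! f hf using htest
  let T' := T.filter fun t : Ωˣ => ∀ s ∈ F, s ^ 2 ≠ (t : Ω)
  have hT' : ∀ t ∈ T', IsSqrtTestPoly (baseAlg k z δ) F (t : Ω) (f t) := fun t ht =>
    hf t (Submonoid.val_mem_of_mem_units _ (hT.1 t (Finset.mem_filter.1 ht).1).1)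
      (Finset.mem_filter.1 ht).2
  refine ⟨T'.image f, ∏ t ∈ T', (f t).leadingCoeff, ?_, ?_, ?_⟩
  · simp only [Finset.forall_mem_image]
    exact fun t ht => ⟨(hT' t ht).1, (Nat.zero_le _).trans_lt (hT' t ht).2.1⟩
  · exact Finset.prod_ne_zero_iff.2 fun t ht =>
      Polynomial.leadingCoeff_ne_zero.2 (hT' t ht).1.ne_zero
  rintro d - φ ⟨hg, -, hirr⟩
  have := IsAlgClosure.isAlgClosed k (K := kbar)
  obtain ⟨ψ, hψ⟩ := exists_ringHom_extension_Dalg η hη (φ : Dalg k z δ η →+* kbar)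
  have hA : ∀ x ∈ Subgroup.closure (S : Set Ωˣ), IsIntegral (baseAlg k z δ) (x : Ω) :=
    fun x hx => isIntegral_of_mem_Dalg η hη (hΓD x hx)
  have hone : ∀ (x : Ωˣ) (hx : x ∈ Subgroup.closure (S : Set Ωˣ)),
      φ ⟨x, hΓD x hx⟩ = 1 → x = 1 := by
    intro x hx hφx
    have hxF := hDF (hΓD x hx)
    have halg : IsAlgebraic k (⟨x, hxF⟩ : F) := by
      refine isAlgebraic_of_forall_exists_pow _ (exists_pow_specialization_eq_one F
        (P := MvPolynomial (Fin m) k) (φ := (baseSpecialization φ).toRingHom) (ψ := ψ)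
        (fun r => hψ r (baseAlg_le_Dalg η r.2)) hA hT (fun t ht hsq => ?_) hxF hx ?_)
      · have htT' : t ∈ T' := Finset.mem_filter.2 ⟨ht, hsq⟩
        refine ⟨f t, hT' t htT', ?_, ?_⟩
        · exact specPoly_eq_map φ (f t) ▸ (hirr (f t) (Finset.mem_image_of_mem f htT')).2
        · refine Polynomial.natDegree_map_of_leadingCoeff_ne_zero _ fun h0 => hg ?_
          have hprod : (baseSpecialization φ).toRingHom.comp (toBaseAlg k z δ).toRingHom
              (∏ t ∈ T', (f t).leadingCoeff) = 0 := by
            rw [map_prod]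
            exact Finset.prod_eq_zero htT' h0
          exact congrArg Subtype.val hprod
      · rw [← hφx]
        exact hψ x (hΓD x hx)
    have halg' : IsAlgebraic k (⟨x, hΓD x hx⟩ - 1 : Dalg k z δ η) := by
      have hx1 : IsAlgebraic k ((x : Ω) - 1) :=
        (halg.algHom (F.restrictScalars k).val).sub isAlgebraic_one
      exact (isAlgebraic_algHom_iff (Dalg k z δ η).val Subtype.val_injective).1 hx1
    have h0 := AlgHom.eq_zero_of_isAlgebraic φ halg' (by rw [map_sub, hφx, map_one, sub_self])
    exact Units.ext (congrArg Subtype.val (sub_eq_zero.1 h0))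
  have hle : algAdj k (Dalg k z δ η) (Units.val '' (Subgroup.closure (S : Set Ωˣ) : Set Ωˣ)) ≤
      Dalg k z δ η := by
    refine Algebra.adjoin_le (Set.union_subset le_rfl ?_)
    rintro _ ⟨u, hu, rfl⟩
    exact hΓD u hu
  refine ⟨φ.comp (Subalgebra.inclusion hle), ?_, ?_⟩
  · rintro _ _ ⟨a, ha, rfl⟩ ⟨b, hb, rfl⟩ hab
    have hb' := inv_mem hb
    have hab' : φ ⟨a, hΓD a ha⟩ = φ ⟨b, hΓD b hb⟩ := hab
    congr 1
    rw [← mul_inv_eq_one]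
    refine hone _ (mul_mem ha hb') ?_
    have h1 : (⟨((a * b⁻¹ : Ωˣ) : Ω), hΓD _ (mul_mem ha hb')⟩ : Dalg k z δ η) =
      ⟨a, hΓD a ha⟩ * ⟨_, hΓD _ hb'⟩ := Subtype.ext (Units.val_mul _ _)
    rw [h1, map_mul, hab', ← map_mul, ← map_one φ]
    congr 1
    exact Subtype.ext (by simp)
  · ext x
    rfl
end
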